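/- Let 1 ≤ P, 2P ≤ L, and 0 < v < 1/2. Let T be the parallel-update TASEP transition matrix on configurations of P particles on a ring of L sites. Then for every t ∈ ℕ and all configurations X and X⁰, the t-step transition probability equals (T^t)(X, X⁰) = F_L(X, X⁰, t) / F_L(X, X, 0), where the denominator equals F_L(X, X, 0) = (1−v)^{N_c(X)−P} ≠ 0. -/

import Mathlib

open Classical

/- `f(a,b,t)` from the paper: `(1+λ)^{-t} (2πi)^{-1} ∮_{|z|=r} (1+λz)^{t+a}(z-1)^{-a}z^{a-b-1} dz`. -/
noncomputable def fInt (lam r : ℝ) (a b : ℤ) (t : ℕ) : ℂ :=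
  ((1 : ℂ) + (lam : ℂ)) ^ (-(t : ℤ)) *
    ((2 * (Real.pi : ℂ) * Complex.I)⁻¹ *
      ∮ z in C(0, r), (1 + (lam : ℂ) * z) ^ ((t : ℤ) + a) * (z - 1) ^ (-a) * z ^ (a - b - 1))

/-- A configuration of `P` particles on a ring of `L` sites: `1 ≤ x₁ < x₂ < ⋯ < x_P ≤ L`. -/
def IsConfig (L P : ℕ) (X : Fin P → ℤ) : Prop :=
  StrictMono X ∧ ∀ i, 1 ≤ X i ∧ X i ≤ L

/-- Number of clusters: the number of particles whose cyclic successor site is empty. -/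
noncomputable def Nc (L : ℕ) {P : ℕ} (X : Fin P → ℤ) : ℕ :=
  (Finset.univ.filter fun i : Fin P =>
    ∀ j : Fin P, X j ≠ (if X i = (L : ℤ) then 1 else X i + 1)).card

/- The cyclic successor of a site on the ring of `L` sites. -/
def succSite (L : ℕ) (s : ℤ) : ℤ := if s = (L : ℤ) then 1 else s + 1

/-- The parallel-update TASEP transition matrix on configurations:
`T(X,X') = v^{|M|}(1-v)^{N_c(X')-|M|}` if `X` is obtained from `X'` by moving the particles of
a subset `M` (each with empty successor site in `X'`) one step forward cyclically; `0` otherwise. -/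
noncomputable def Tmat (v : ℝ) (L P : ℕ) (X X' : Fin P → ℤ) : ℝ :=
  if IsConfig L P X ∧ IsConfig L P X' then
    ∑ M : Finset (Fin P),
      if (∀ i ∈ M, ∀ j, X' j ≠ succSite L (X' i)) ∧
          (Finset.image X Finset.univ =
            Finset.image (fun i => if i ∈ M then succSite L (X' i) else X' i) Finset.univ)
        then v ^ M.card * (1 - v) ^ ((Nc L X' : ℤ) - M.card)
      else 0
  else 0

/-- `t`-step transition probabilities: `(T^t)(X,X⁰) = Σ_{X₁,…,X_{t-1}} T(X,X_{t-1})⋯T(X₁,X⁰)`. -/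
noncomputable def Tpow (v : ℝ) (L P : ℕ) : ℕ → (Fin P → ℤ) → (Fin P → ℤ) → ℝ
  | 0 => fun X Y => if X = Y then 1 else 0
  | t + 1 => fun X Y => ∑' Z : Fin P → ℤ, Tmat v L P X Z * Tpow v L P t Z Y

/-- `F_L(X,Y,t)`: the `P`-tuple sum of determinants. -/
noncomputable def FL (lam r : ℝ) (L : ℕ) {P : ℕ} (X Y : Fin P → ℤ) (t : ℕ) : ℂ :=
  ∑' n : Fin P → ℤ,
    (-1 : ℂ) ^ (((P : ℤ) - 1) * ∑ i, n i) *
      Matrix.det (Matrix.of fun i j : Fin P =>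
        fInt lam r (((i : ℕ) : ℤ) - ((j : ℕ) : ℤ) + (P : ℤ) * n i - ∑ k, n k)
          (X i - Y j + n i * L) t)

noncomputable def gI (lam : ℝ) (a b t : ℤ) (z : ℂ) : ℂ :=
  (1 + (lam : ℂ) * z) ^ (t + a) * (z - 1) ^ (-a) * z ^ (a - b - 1)

lemma circ_ne {lam r : ℝ} (hl : 0 < lam) (hr1 : 1 < r) (hr2 : r < 1 / lam) {z : ℂ}
    (hz : z ∈ Metric.sphere (0:ℂ) r) : z ≠ 0 ∧ z - 1 ≠ 0 ∧ 1 + (lam : ℂ) * z ≠ 0 := by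
  have hz' : ‖z‖ = r := by simpa using hz
  have h1 : lam * r < 1 := by
    rw [lt_div_iff₀ hl] at hr2; linarith
  refine ⟨?_, ?_, ?_⟩
  · rintro rfl; simp at hz'; linarith
  · intro h
    have : z = 1 := by linear_combination h
    rw [this] at hz'; simp at hz'; linarith
  · intro h
    have : (lam : ℂ) * z = -1 := by linear_combination h
    have h2 := congrArg norm this
    rw [norm_mul, hz', Complex.norm_real, Real.norm_of_nonneg hl.le] at h2
    simp at h2; linarith

lemma disc_ne {lam r : ℝ} (hl : 0 < lam) (hr2 : r < 1 / lam) {z : ℂ}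
    (hz : ‖z‖ ≤ r) : 1 + (lam : ℂ) * z ≠ 0 := by
  have h1 : lam * r < 1 := by
    rw [lt_div_iff₀ hl] at hr2; linarith
  intro h
  have : (lam : ℂ) * z = -1 := by linear_combination h
  have h2 := congrArg norm this
  rw [norm_mul, Complex.norm_real, Real.norm_of_nonneg hl.le] at h2
  simp at h2
  nlinarith

lemma gI_int {lam r : ℝ} (hl : 0 < lam) (hr1 : 1 < r) (hr2 : r < 1 / lam) (a b t : ℤ) :
    CircleIntegrable (gI lam a b t) 0 r := by
  apply ContinuousOn.circleIntegrable (by linarith)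
  unfold gI
  intro z hz
  obtain ⟨h1, h2, h3⟩ := circ_ne hl hr1 hr2 hz
  apply ContinuousAt.continuousWithinAt
  refine ContinuousAt.mul (ContinuousAt.mul ?_ ?_) ?_
  · exact ContinuousAt.zpow₀ (by fun_prop) _ (Or.inl h3)
  · exact ContinuousAt.zpow₀ (by fun_prop) _ (Or.inl h2)
  · exact ContinuousAt.zpow₀ (by fun_prop) _ (Or.inl h1)

lemma gI_ev {lam r : ℝ} (hl : 0 < lam) (hr1 : 1 < r) (hr2 : r < 1 / lam) (a b t : ℤ) :
    (∮ z in C(0, r), gI lam a b (t+1) z) =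
      (∮ z in C(0, r), gI lam a b t z) + lam * ∮ z in C(0, r), gI lam a (b-1) t z := by
  rw [← circleIntegral.integral_const_mul, ← circleIntegral.integral_add (gI_int hl hr1 hr2 _ _ _)]
  · apply circleIntegral.integral_congr (by linarith)
    intro z hz
    obtain ⟨h1, h2, h3⟩ := circ_ne hl hr1 hr2 hz
    simp only [gI]
    rw [show t + 1 + a = t + a + 1 by ring, zpow_add_one₀ h3,
      show a - (b - 1) - 1 = (a - b - 1) + 1 by ring, zpow_add_one₀ h1]
    ring
  · exact (gI_int hl hr1 hr2 _ _ _).const_fun_smul (a := (lam:ℂ))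

lemma gI_bd {lam r : ℝ} (hl : 0 < lam) (hr1 : 1 < r) (hr2 : r < 1 / lam) (a b t : ℤ) :
    (∮ z in C(0, r), gI lam (a+1) b t z) - (∮ z in C(0, r), gI lam (a+1) (b+1) t z) =
      (∮ z in C(0, r), gI lam a b t z) + lam * ∮ z in C(0, r), gI lam a (b-1) t z := by
  rw [← circleIntegral.integral_const_mul, ← circleIntegral.integral_add (gI_int hl hr1 hr2 _ _ _),
    ← circleIntegral.integral_sub (gI_int hl hr1 hr2 _ _ _) (gI_int hl hr1 hr2 _ _ _)]
  · apply circleIntegral.integral_congr (by linarith)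
    intro z hz
    obtain ⟨h1, h2, h3⟩ := circ_ne hl hr1 hr2 hz
    simp only [gI]
    rw [show t + (a + 1) = t + a + 1 by ring, zpow_add_one₀ h3,
      show a - (b - 1) - 1 = (a - b - 1) + 1 by ring, zpow_add_one₀ h1,
      show a + 1 - b - 1 = (a - b - 1) + 1 by ring, zpow_add_one₀ h1,
      show a + 1 - (b + 1) - 1 = (a - b - 1) by ring,
      show -(a+1) = -a - 1 by ring, zpow_sub_one₀ h2]
    field_simp
  · exact (gI_int hl hr1 hr2 _ _ _).const_fun_smul (a := (lam:ℂ))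

lemma gI_z2 {lam r : ℝ} (hl : 0 < lam) (hr1 : 1 < r) (hr2 : r < 1 / lam) (a b t : ℤ)
    (ha : a ≤ 0) (hb : b < a) : (∮ z in C(0, r), gI lam a b t z) = 0 := by
  have hd : ∀ z : ℂ, ‖z‖ ≤ r → DifferentiableAt ℂ (gI lam a b t) z := by
    intro z hz
    unfold gI
    refine DifferentiableAt.mul (DifferentiableAt.mul ?_ ?_) ?_
    · exact DifferentiableAt.zpow (by fun_prop) (Or.inl (disc_ne hl hr2 hz))
    · exact DifferentiableAt.zpow (by fun_prop) (Or.inr (by omega))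
    · exact DifferentiableAt.zpow (by fun_prop) (Or.inr (by omega))
  apply Complex.circleIntegral_eq_zero_of_differentiable_on_off_countable (by linarith)
    (s := ∅) Set.countable_empty
  · intro z hz
    exact (hd z (by simpa using hz)).continuousAt.continuousWithinAt
  · intro z hz
    exact hd z (by simpa using (Metric.mem_ball.mp hz.1).le)

lemma gI_z1 {lam r : ℝ} (hl : 0 < lam) (hr1 : 1 < r) (a b t : ℤ)
    (ha : 0 ≤ t + a) (hb : t + a < b) : (∮ z in C(0, r), gI lam a b t z) = 0 := by
  have hd : ∀ z : ℂ, 1 < ‖z‖ → DifferentiableAt ℂ (gI lam a b t) z := by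
    intro z hz
    have h0 : z ≠ 0 := by rintro rfl; simp at hz; linarith
    have h1 : z - 1 ≠ 0 := by
      intro h
      have : z = 1 := by linear_combination h
      rw [this] at hz; simp at hz
    unfold gI
    refine DifferentiableAt.mul (DifferentiableAt.mul ?_ ?_) ?_
    · exact DifferentiableAt.zpow (by fun_prop) (Or.inr ha)
    · exact DifferentiableAt.zpow (by fun_prop) (Or.inl h1)
    · exact DifferentiableAt.zpow (by fun_prop) (Or.inl h0)
  have hR : ∀ R : ℝ, r ≤ R → (∮ z in C(0, r), gI lam a b t z) = ∮ z in C(0, R), gI lam a b t z := by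
    intro R hR
    symm
    apply Complex.circleIntegral_eq_of_differentiable_on_annulus_off_countable (by linarith) hR
      (s := ∅) Set.countable_empty
    · intro z hz
      have : r ≤ ‖z‖ := by simpa using hz.2
      exact (hd z (by linarith)).continuousAt.continuousWithinAt
    · intro z hz
      have : r < ‖z‖ := by simpa using hz.1.2
      exact hd z (by linarith)
  -- bound
  obtain ⟨m, hm⟩ := Int.eq_ofNat_of_zero_le ha
  have hbd : ∃ C : ℝ, ∀ R : ℝ, 2 ≤ R → ∀ z ∈ Metric.sphere (0:ℂ) R, ‖gI lam a b t z‖ ≤ C * R ^ (t + a - b - 1) := by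
    refine ⟨(1 + lam) ^ m * 2 ^ |a|, ?_⟩
    intro R hR z hz
    have hz' : ‖z‖ = R := by simpa using hz
    have hR0 : 0 < R := by linarith
    unfold gI
    rw [norm_mul, norm_mul, norm_zpow, norm_zpow, norm_zpow, hz', hm]
    have e1 : ‖1 + (lam:ℂ) * z‖ ^ ((m:ℕ):ℤ) ≤ ((1 + lam) * R) ^ m := by
      rw [zpow_natCast]
      apply pow_le_pow_left₀ (norm_nonneg _)
      calc _ ≤ ‖(1:ℂ)‖ + ‖(lam:ℂ) * z‖ := norm_add_le _ _
        _ = 1 + lam * R := by rw [norm_mul, hz', Complex.norm_real, Real.norm_of_nonneg hl.le]; simp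
        _ ≤ _ := by nlinarith
    have e2 : ‖z - 1‖ ^ (-a) ≤ 2 ^ |a| * R ^ (-a) := by
      have l1 : ‖z - 1‖ ≤ 2 * R := by
        calc _ ≤ ‖z‖ + ‖(1:ℂ)‖ := norm_sub_le _ _
          _ ≤ _ := by rw [hz']; simp; linarith
      have l2 : R / 2 ≤ ‖z - 1‖ := by
        have := norm_sub_norm_le z 1
        rw [hz'] at this; simp at this; linarith
      rcases le_total a 0 with h | h
      · rw [abs_of_nonpos h]
        obtain ⟨k, hk⟩ := Int.eq_ofNat_of_zero_le (show 0 ≤ -a by omega)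
        rw [hk]; simp only [zpow_natCast]; rw [← mul_pow]
        exact pow_le_pow_left₀ (norm_nonneg _) l1 _
      · rw [abs_of_nonneg h]
        obtain ⟨k, rfl⟩ := Int.eq_ofNat_of_zero_le h
        simp only [zpow_neg, zpow_natCast]
        rw [← div_eq_mul_inv, ← inv_div, ← div_pow]
        apply inv_anti₀ (by positivity)
        exact pow_le_pow_left₀ (by positivity) l2 _
    calc _ ≤ ((1 + lam) * R) ^ m * (2 ^ |a| * R ^ (-a)) * R ^ (a - b - 1) := by gcongr
      _ = (1 + lam) ^ m * 2 ^ |a| * (R ^ ((m:ℕ):ℤ) * R ^ (-a) * R ^ (a - b - 1)) := by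
          rw [mul_pow, zpow_natCast]; ring
      _ = _ := by rw [← zpow_add₀ hR0.ne', ← zpow_add₀ hR0.ne']; congr 2; ring
  obtain ⟨C, hC⟩ := hbd
  have hC0 : 0 ≤ C := by
    have := hC 2 le_rfl 2 (by simp)
    by_contra h
    have h2 : C * (2:ℝ) ^ (t + a - b - 1) < 0 := mul_neg_of_neg_of_pos (by linarith) (by positivity)
    linarith [norm_nonneg (gI lam a b t 2)]
  have key : ∀ R : ℝ, max r 2 ≤ R → ‖∮ z in C(0, r), gI lam a b t z‖ ≤ 2 * Real.pi * C * R⁻¹ := by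
    intro R h
    have h1 := le_trans (le_max_left _ _) h
    have h2 := le_trans (le_max_right _ _) h
    rw [hR R h1]
    have h3 := circleIntegral.norm_integral_le_of_norm_le_const (f := gI lam a b t) (c := 0) (R := R) (by linarith)
      (hC R h2)
    refine h3.trans ?_
    have hR0 : 0 < R := by linarith
    calc _ = 2 * Real.pi * C * (R * R ^ (t + a - b - 1)) := by ring
      _ ≤ _ := by
        apply mul_le_mul_of_nonneg_left _ (by positivity)
        rw [← zpow_one_add₀ hR0.ne', ← zpow_neg_one]
        exact zpow_le_zpow_right₀ (by linarith) (by omega)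
  have lim : Filter.Tendsto (fun R : ℝ => 2 * Real.pi * C * R⁻¹) Filter.atTop (nhds 0) := by
    simpa using tendsto_inv_atTop_zero.const_mul (2 * Real.pi * C)
  have : ‖∮ z in C(0, r), gI lam a b t z‖ ≤ 0 :=
    ge_of_tendsto lim (Filter.eventually_atTop.mpr ⟨_, key⟩)
  exact norm_le_zero_iff.mp this

structure Good (f : ℤ → ℤ → ℕ → ℂ) (v lam : ℂ) : Prop where
  hv : 1 - v ≠ 0
  hl : lam * (1 - v) = v
  ev : ∀ a b t, f a b (t+1) = (1 - v) * f a b t + v * f a (b-1) t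
  bd : ∀ a b t, f (a+1) b t - f (a+1) (b+1) t = f a b t + lam * f a (b-1) t
  z1 : ∀ a b (t : ℕ), 0 ≤ (t:ℤ) + a → (t:ℤ) + a < b → f a b t = 0
  z2 : ∀ a b (t : ℕ), a ≤ 0 → b < a → f a b t = 0
  one : f 0 0 0 = 1

lemma good_fInt {v r : ℝ} (hv0 : 0 < v) (hv1 : v < 1 / 2) (hr1 : 1 < r)
    (hr2 : r < 1 / (v / (1 - v))) : Good (fInt (v / (1 - v)) r) v ((v / (1 - v) : ℝ) : ℂ) := by
  have hv : (1 : ℝ) - v ≠ 0 := by linarith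
  have hvc : (1 : ℂ) - v ≠ 0 := by exact_mod_cast hv
  set lam := v / (1 - v) with hlam
  have hl : 0 < lam := div_pos hv0 (by linarith)
  have hf : ∀ a b t, fInt lam r a b t = (1 - v : ℂ) ^ (t:ℕ) *
      ((2 * (Real.pi : ℂ) * Complex.I)⁻¹ * ∮ z in C(0, r), gI lam a b t z) := by
    intro a b t
    have : (1 : ℂ) + (lam:ℂ) = (1 - v : ℂ)⁻¹ := by
      rw [hlam]; push_cast; field_simp; ring
    unfold fInt gI
    rw [this]; simp
  have hlc : (lam : ℂ) * (1 - v) = v := by rw [hlam]; push_cast; field_simp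
  refine ⟨hvc, hlc, ?_, ?_, ?_, ?_, ?_⟩
  · intro a b t
    rw [hf, hf, hf]; push_cast
    rw [gI_ev hl hr1 hr2, pow_succ]
    linear_combination (1 - v : ℂ) ^ (t:ℕ) *
      ((2 * (Real.pi : ℂ) * Complex.I)⁻¹ * ∮ z in C(0, r), gI lam a (b-1) t z) * hlc
  · intro a b t
    rw [hf, hf, hf, hf]
    linear_combination (1 - v : ℂ) ^ (t:ℕ) * (2 * (Real.pi : ℂ) * Complex.I)⁻¹ * gI_bd hl hr1 hr2 a b t
  · intro a b t h1 h2
    rw [hf, gI_z1 hl hr1 _ _ _ h1 h2]; simp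
  · intro a b t h1 h2
    rw [hf, gI_z2 hl hr1 hr2 _ _ _ h1 h2]; simp
  · rw [hf]
    have : (∮ z in C(0, r), gI lam 0 0 ((0:ℕ):ℤ) z) = 2 * Real.pi * Complex.I := by
      rw [← circleIntegral.integral_sub_center_inv (0:ℂ) (R := r) (by linarith)]
      apply circleIntegral.integral_congr (by linarith)
      intro z hz
      simp [gI]
    rw [this]
    have : (2 * (Real.pi : ℂ) * Complex.I) ≠ 0 := by simp
    rw [inv_mul_cancel₀ this]; simp

section alg
variable {p : ℕ} {f : ℤ → ℤ → ℕ → ℂ} {v lam : ℂ}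

noncomputable def ent (f : ℤ → ℤ → ℕ → ℂ) (L : ℤ) (X Y : Fin (p+1) → ℤ) (t : ℕ)
    (n : Fin (p+1) → ℤ) : Matrix (Fin (p+1)) (Fin (p+1)) ℂ :=
  Matrix.of fun i j => f (((i : ℕ) : ℤ) - ((j : ℕ) : ℤ) + ((p+1 : ℕ) : ℤ) * n i - ∑ k, n k)
          (X i - Y j + n i * L) t

noncomputable def sg (p : ℕ) (n : Fin (p+1) → ℤ) : ℂ :=
  (-1 : ℂ) ^ ((((p+1 : ℕ) : ℤ) - 1) * ∑ i, n i)

noncomputable def FF (f : ℤ → ℤ → ℕ → ℂ) (L : ℤ) (X Y : Fin (p+1) → ℤ) (t : ℕ) : ℂ :=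
  ∑' n : Fin (p+1) → ℤ, sg p n * (ent f L X Y t n).det

def rotX (L : ℤ) (X : Fin (p+1) → ℤ) : Fin (p+1) → ℤ :=
  fun i => X (i + 1) + if i + 1 = 0 then L else 0

def rotE (p : ℕ) : (Fin (p+1) → ℤ) ≃ (Fin (p+1) → ℤ) where
  toFun n := fun k => n (k - 1) + if k = 0 then 1 else 0
  invFun n := fun k => n (k + 1) - if k + 1 = 0 then 1 else 0
  left_inv n := by ext k; simp
  right_inv n := by ext k; simp

lemma rotE_sum (n : Fin (p+1) → ℤ) : ∑ k, rotE p n k = ∑ k, n k + 1 := by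
  simp only [rotE, Equiv.coe_fn_mk, Finset.sum_add_distrib]
  rw [Finset.sum_ite_eq' Finset.univ (0 : Fin (p+1)) (fun _ => (1:ℤ))]
  simp only [Finset.mem_univ, if_true]
  congr 1
  exact Equiv.sum_comp (Equiv.subRight (1 : Fin (p+1))) n

lemma val_succ_cyc (i : Fin (p+1)) :
    (((i + 1 : Fin (p+1)) : ℕ) : ℤ) = (i : ℕ) + 1 - if i + 1 = 0 then ((p+1 : ℕ) : ℤ) else 0 := by
  rcases eq_or_ne i (Fin.last p) with rfl | h
  · simp
  · have h1 : ((i + 1 : Fin (p+1)) : ℕ) = (i : ℕ) + 1 := by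
      rw [Fin.val_add_one]; simp [h]
    have h2 : i + 1 ≠ 0 := by
      intro h3; rw [h3] at h1; simp at h1
    rw [h1]; simp [h2]

lemma FF_rot (L : ℤ) (X Y : Fin (p+1) → ℤ) (t : ℕ) : FF f L (rotX L X) Y t = FF f L X Y t := by
  unfold FF
  rw [← (rotE p).tsum_eq (fun n => sg p n * (ent f L X Y t n).det)]
  congr 1; ext n
  have h1 : ent f L (rotX L X) Y t n = (ent f L X Y t (rotE p n)).submatrix (finRotate (p+1)) id := by
    ext i j
    simp only [ent, Matrix.of_apply, Matrix.submatrix_apply, finRotate_apply, id, rotE_sum]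
    rw [val_succ_cyc]
    have h2 : rotE p n (i + 1) = n i + if i + 1 = 0 then 1 else 0 := by simp [rotE]
    rw [h2]; unfold rotX
    split_ifs <;> congr 1 <;> ring
  rw [h1, Matrix.det_permute, sign_finRotate]
  unfold sg
  rw [rotE_sum]
  have h3 : ((-1:ℂ)) ≠ 0 := by norm_num
  rw [mul_add, zpow_add₀ h3, mul_one]
  have h4 : ((-1:ℂ)) ^ (((p+1 : ℕ) : ℤ) - 1) = (-1) ^ p := by
    rw [show ((p+1 : ℕ) : ℤ) - 1 = (p : ℤ) by push_cast; ring, zpow_natCast]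
  rw [h4]
  simp
  ring

/-- finite support -/
lemma fin_supp (L : ℤ) (hL : (p:ℤ) + 1 < L) (C : ℤ)
    (D : (Fin (p+1) → ℤ) → Matrix (Fin (p+1)) (Fin (p+1)) ℂ)
    (hD : ∀ n i j, D n i j ≠ 0 →
      (0 ≤ ((i : ℕ) : ℤ) - ((j : ℕ) : ℤ) + ((p:ℤ)+1) * n i - ∑ k, n k →
        n i * L ≤ ((p:ℤ)+1) * n i - ∑ k, n k + C) ∧
      (((i : ℕ) : ℤ) - ((j : ℕ) : ℤ) + ((p:ℤ)+1) * n i - ∑ k, n k ≤ 0 →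
        ((p:ℤ)+1) * n i - ∑ k, n k ≤ n i * L + C)) :
    {n | (D n).det ≠ 0}.Finite := by
  set K : ℤ := |C| + 2 * (p+1) + 2 * (p+1) * |C| + 2 with hK
  apply (Set.finite_Icc (fun _ => -K : Fin (p+1) → ℤ) (fun _ => K)).subset
  intro n hn
  simp only [Set.mem_ofPred_eq, Matrix.det_apply] at hn
  obtain ⟨σ, -, hσ⟩ := Finset.exists_ne_zero_of_sum_ne_zero hn
  have hne : ∀ i, D n (σ i) i ≠ 0 := by
    intro i hi
    apply hσ
    rw [Finset.prod_eq_zero (f := fun i => D n (σ i) i) (Finset.mem_univ i) hi, smul_zero]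
  set N := ∑ k, n k with hN
  let a : Fin (p+1) → ℤ := fun j => ((σ j : ℕ) : ℤ) - ((j : ℕ) : ℤ) + ((p:ℤ)+1) * n (σ j) - N
  have ha : ∑ j, a j = 0 := by
    simp only [a, Finset.sum_sub_distrib, Finset.sum_add_distrib, ← Finset.mul_sum]
    rw [Equiv.sum_comp σ n, Equiv.sum_comp σ (fun i => ((i : ℕ):ℤ))]
    simp [← hN]
  obtain ⟨jp, -, hjp⟩ := Finset.exists_max_image Finset.univ a ⟨0, Finset.mem_univ _⟩
  obtain ⟨jq, -, hjq⟩ := Finset.exists_min_image Finset.univ a ⟨0, Finset.mem_univ _⟩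
  have hp0 : 0 ≤ a jp := by
    by_contra h
    have : ∑ j, a j < 0 := Finset.sum_neg (fun i hi => lt_of_le_of_lt (hjp i hi) (not_le.mp h)) ⟨0, Finset.mem_univ _⟩
    omega
  have hq0 : a jq ≤ 0 := by
    by_contra h
    have : 0 < ∑ j, a j := Finset.sum_pos (fun i hi => lt_of_lt_of_le (not_le.mp h) (hjq i hi)) ⟨0, Finset.mem_univ _⟩
    omega
  have e1 := (hD n _ _ (hne jp)).1 hp0
  have e2 := (hD n _ _ (hne jq)).2 hq0
  have hb : ∀ i : Fin (p+1), 0 ≤ ((i:ℕ):ℤ) ∧ ((i:ℕ):ℤ) ≤ p := by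
    intro i; have := i.2; omega
  have up : ∀ i, n i ≤ n (σ jp) + 2 := by
    intro i
    have h := hjp (σ.symm i) (Finset.mem_univ _)
    simp only [a, Equiv.apply_symm_apply] at h
    have b1 := hb i; have b2 := hb (σ.symm i); have b3 := hb jp; have b4 := hb (σ jp)
    by_contra hc
    have : n (σ jp) + 3 ≤ n i := by omega
    nlinarith
  have lo : ∀ i, n (σ jq) - 2 ≤ n i := by
    intro i
    have h := hjq (σ.symm i) (Finset.mem_univ _)
    simp only [a, Equiv.apply_symm_apply] at h
    have b1 := hb i; have b2 := hb (σ.symm i); have b3 := hb jq; have b4 := hb (σ jq)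
    by_contra hc
    have : n i + 3 ≤ n (σ jq) := by omega
    nlinarith
  rw [← hN] at e1 e2
  set x := n (σ jp)
  set y := n (σ jq)
  have N1 : N ≤ (p+1) * (x + 2) := by
    calc N ≤ ∑ _k : Fin (p+1), (x + 2) := Finset.sum_le_sum fun i _ => up i
      _ = _ := by simp
  have N2 : (p+1) * (y - 2) ≤ N := by
    calc N ≥ ∑ _k : Fin (p+1), (y - 2) := Finset.sum_le_sum fun i _ => lo i
      _ = _ := by simp; ring
  have hC := le_abs_self C
  have hC0 := abs_nonneg C
  have hp : (0:ℤ) ≤ p := by positivity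
  have d : x - y ≤ 2 * |C| := by
    by_contra hc
    have : 1 ≤ L - (p+1) := by omega
    nlinarith
  have hd' : (p+1) * (x - y) ≤ (p+1) * (2 * |C|) := mul_le_mul_of_nonneg_left d (by omega)
  have bx : x ≤ K - 2 := by
    have : x * L ≤ |C| + 2 * (p+1) + 2 * (p+1) * |C| := by nlinarith
    by_contra hc
    have h0 : 0 ≤ |C| + 2 * (p+1) + 2 * (p+1) * |C| := by positivity
    nlinarith
  have hby : -(K - 2) ≤ y := by
    have : -(|C| + 2 * (p+1) + 2 * (p+1) * |C|) ≤ y * L := by nlinarith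
    by_contra hc
    have h0 : 0 ≤ |C| + 2 * (p+1) + 2 * (p+1) * |C| := by positivity
    nlinarith
  constructor
  · intro i; have := lo i; simp only; omega
  · intro i; have := up i; simp only; omega

end alg

section alg2
variable {p : ℕ} {f : ℤ → ℤ → ℕ → ℂ} {v lam : ℂ}

def fst (L : ℤ) (X : Fin (p+1) → ℤ) (i : Fin (p+1)) : Prop :=
  X i ≠ X (i - 1) + 1 - if i = 0 then L else 0

lemma fst_rot (L : ℤ) (X : Fin (p+1) → ℤ) (i : Fin (p+1)) :
    fst L (rotX L X) i ↔ fst L X (i + 1) := by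
  unfold fst rotX
  simp only [sub_add_cancel, add_sub_cancel_right, ne_eq]
  by_cases h1 : i + 1 = 0 <;> by_cases h2 : i = 0 <;> simp only [h1, h2, if_true, if_false] <;> omega

noncomputable def mix (f : ℤ → ℤ → ℕ → ℂ) (L : ℤ) (X Y : Fin (p+1) → ℤ) (t : ℕ)
    (A : Set (Fin (p+1))) (n : Fin (p+1) → ℤ) : Matrix (Fin (p+1)) (Fin (p+1)) ℂ :=
  Matrix.of fun i j => if i ∈ A then ent f L X Y (t+1) n i j else ent f L X Y t n i j

lemma mix_summable (hf : Good f v lam) (L : ℤ) (hL : (p:ℤ) + 1 < L) (X Y : Fin (p+1) → ℤ) (t : ℕ)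
    (A : Set (Fin (p+1))) : Summable fun n => sg p n * (mix f L X Y t A n).det := by
  have hfin : {n | (mix f L X Y t A n).det ≠ 0}.Finite := by
    apply fin_supp L hL ((t:ℤ) + 1 + p + ∑ i, |X i| + ∑ i, |Y i|)
    intro n i j hne
    have hx : |X i| ≤ ∑ i, |X i| := Finset.single_le_sum (f := fun i => |X i|) (fun i _ => abs_nonneg _) (Finset.mem_univ i)
    have hy : |Y j| ≤ ∑ i, |Y i| := Finset.single_le_sum (f := fun i => |Y i|) (fun i _ => abs_nonneg _) (Finset.mem_univ j)
    have hx1 := abs_le.mp hx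
    have hy1 := abs_le.mp hy
    have hi := i.2
    have hj := j.2
    have key : ∃ t' : ℕ, t' ≤ t + 1 ∧ ent f L X Y t' n i j ≠ 0 := by
      simp only [mix, Matrix.of_apply] at hne
      split_ifs at hne
      · exact ⟨t+1, le_rfl, hne⟩
      · exact ⟨t, by omega, hne⟩
    obtain ⟨t', ht', hne'⟩ := key
    simp only [ent, Matrix.of_apply] at hne'
    push_cast at hne'
    set N := ∑ k, n k
    set Q := ((p:ℤ)+1) * n i
    set R := n i * L
    constructor
    · intro h
      by_contra hc
      exact hne' (hf.z1 _ _ _ (by omega) (by omega))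
    · intro h
      by_contra hc
      exact hne' (hf.z2 _ _ _ (by omega) (by omega))
  apply summable_of_hasFiniteSupport
  apply hfin.subset
  intro n hn h
  apply hn
  simp [h]

noncomputable def Phi (f : ℤ → ℤ → ℕ → ℂ) (L : ℤ) (X Y : Fin (p+1) → ℤ) (t : ℕ)
    (A : Set (Fin (p+1))) : ℂ := ∑' n, sg p n * (mix f L X Y t A n).det

lemma Good.step (hf : Good f v lam) (a b : ℤ) (t : ℕ) :
    f (a+1) (b+1) (t+1) = f (a+1) (b+1) t + lam * f a b (t+1) := by
  have h1 := hf.ev (a+1) (b+1) t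
  have h2 := hf.ev a b t
  have h3 := hf.bd a b t
  have h4 := hf.hl
  rw [add_sub_cancel_right] at h1
  rw [h1, h2]
  linear_combination v * h3 - h4 * f a b t

lemma Phi_insert (hf : Good f v lam) (L : ℤ) (hL : (p:ℤ) + 1 < L) (X Y : Fin (p+1) → ℤ) (t : ℕ)
    (A : Set (Fin (p+1))) (k : Fin (p+1)) (hk : k ≠ 0) (hkA : k ∉ A) (hk1 : k - 1 ∈ A)
    (hX : X k = X (k-1) + 1) : Phi f L X Y t (insert k A) = Phi f L X Y t A := by
  have hp : k - 1 ≠ k := by intro h; rw [h] at hk1; exact hkA hk1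
  have hval : ((k : ℕ) : ℤ) = ((k - 1 : Fin (p+1)) : ℕ) + 1 := by
    have := val_succ_cyc (k - 1)
    simpa [hk] using this
  let Z : (Fin (p+1) → ℤ) → Fin (p+1) → ℂ := fun n j =>
    f (((k-1 : Fin (p+1)) : ℕ) - ((j : ℕ) : ℤ) + ((p+1 : ℕ) : ℤ) * n k - ∑ k, n k)
          (X (k-1) - Y j + n k * L) (t+1)
  let D := fun n => (mix f L X Y t A n).updateRow k (Z n)
  have h1 : ∀ n, (mix f L X Y t (insert k A) n).det = (mix f L X Y t A n).det + lam * (D n).det := by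
    intro n
    have e : mix f L X Y t (insert k A) n =
        (mix f L X Y t A n).updateRow k ((mix f L X Y t A n) k + lam • Z n) := by
      ext i j
      by_cases hi : i = k
      · subst hi
        simp only [mix, ent, Matrix.of_apply, Set.mem_insert_iff, true_or, if_true,
          Matrix.updateRow_self, Pi.add_apply, Pi.smul_apply, smul_eq_mul, Z, hkA, if_false]
        have := hf.step (((i-1 : Fin (p+1)) : ℕ) - ((j : ℕ) : ℤ) + ((p+1 : ℕ) : ℤ) * n i - ∑ k, n k)
          (X (i-1) - Y j + n i * L) t
        rw [hval, hX]
        convert this using 2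
        · ring
        · ring
        · congr 1 <;> ring
      · rw [Matrix.updateRow_ne hi]
        simp [mix, hi]
    rw [e, Matrix.det_updateRow_add, Matrix.det_updateRow_smul, Matrix.updateRow_eq_self]
  have h2 : ∑' n, sg p n * (D n).det = 0 := by
    let e : (Fin (p+1) → ℤ) ≃ (Fin (p+1) → ℤ) := Equiv.arrowCongr (Equiv.swap (k-1) k) (Equiv.refl ℤ)
    have he : ∀ n i, e n i = n (Equiv.swap (k-1) k i) := by intro n i; simp [e]
    have hs : ∀ n, ∑ i, e n i = ∑ i, n i := by
      intro n; simp only [he]; exact Equiv.sum_comp _ n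
    have hs' : ∀ n : Fin (p+1) → ℤ, ∑ i, n (Equiv.swap (k-1) k i) = ∑ i, n i :=
      fun n => Equiv.sum_comp _ n
    have h3 : ∑' n, sg p n * (D n).det = ∑' n, -(sg p n * (D n).det) := by
      rw [← e.tsum_eq]
      congr 1; ext n
      have h4 : D (e n) = (D n).submatrix (Equiv.swap (k-1) k) id := by
        ext i j
        have hDd : ∀ n, D n = (mix f L X Y t A n).updateRow k (Z n) := fun _ => rfl
        rw [Matrix.submatrix_apply, hDd, hDd]
        by_cases hi : i = k
        · subst hi
          rw [Equiv.swap_apply_right, Matrix.updateRow_self, Matrix.updateRow_ne hp]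
          simp only [mix, ent, Matrix.of_apply, hk1, if_true, Z, hs', he, Equiv.swap_apply_right, id]
        · by_cases hi2 : i = k - 1
          · subst hi2
            rw [Equiv.swap_apply_left, Matrix.updateRow_self, Matrix.updateRow_ne hi]
            simp only [mix, ent, Matrix.of_apply, hk1, if_true, Z, hs', he, Equiv.swap_apply_left, id]
          · rw [Equiv.swap_apply_of_ne_of_ne hi2 hi, Matrix.updateRow_ne hi, Matrix.updateRow_ne hi]
            simp only [mix, ent, Matrix.of_apply, hs', he, Equiv.swap_apply_of_ne_of_ne hi2 hi, id]
      rw [h4, Matrix.det_permute, Equiv.Perm.sign_swap hp]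
      unfold sg
      rw [hs]; simp
    rw [tsum_neg] at h3
    linear_combination h3 / 2
  unfold Phi
  rw [← sub_eq_zero, ← (mix_summable hf L hL X Y t _).tsum_sub (mix_summable hf L hL X Y t _)]
  have h5 : ∀ n, sg p n * (mix f L X Y t (insert k A) n).det - sg p n * (mix f L X Y t A n).det
      = lam * (sg p n * (D n).det) := by
    intro n; rw [h1]; ring
  simp only [h5]
  rw [tsum_mul_left, h2, mul_zero]

lemma Phi_chain (hf : Good f v lam) (L : ℤ) (hL : (p:ℤ) + 1 < L) (X Y : Fin (p+1) → ℤ) (t : ℕ)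
    (h0 : fst L X 0) (m : ℕ) (hm : m ≤ p + 1) :
    Phi f L X Y t {i | (i : ℕ) < m ∨ fst L X i} = Phi f L X Y t {i | fst L X i} := by
  induction m with
  | zero => simp
  | succ m ih =>
    rw [← ih (by omega)]
    let k : Fin (p+1) := ⟨m, by omega⟩
    have hs : {i : Fin (p+1) | (i : ℕ) < m + 1 ∨ fst L X i} = insert k {i : Fin (p+1) | (i : ℕ) < m ∨ fst L X i} := by
      ext i
      have : i = k ↔ (i:ℕ) = m := by simp [k, Fin.ext_iff]
      simp only [Set.mem_ofPred_eq, Set.mem_insert_iff, this]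
      rw [Nat.lt_succ_iff_lt_or_eq]; tauto
    by_cases hk : fst L X k
    · rw [hs, Set.insert_eq_of_mem]
      right; exact hk
    · have hk0 : k ≠ 0 := by rintro h; rw [h] at hk; exact hk h0
      have hval : ((k : ℕ) : ℤ) = ((k - 1 : Fin (p+1)) : ℕ) + 1 := by
        have := val_succ_cyc (k - 1)
        simpa [hk0] using this
      rw [hs, Phi_insert hf L hL X Y t _ k hk0]
      · rintro (h | h)
        · simp [k] at h
        · exact hk h
      · left
        have : (k:ℕ) = m := rfl
        omega
      · unfold fst at hk
        simpa [hk0] using hk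

noncomputable def cf (L : ℤ) (v : ℂ) (X : Fin (p+1) → ℤ) (M : Finset (Fin (p+1))) : ℂ :=
  ∏ i, if i ∈ M then (if fst L X i then v else 0) else (if fst L X i then 1 - v else 1)

noncomputable def Xs (X : Fin (p+1) → ℤ) (M : Finset (Fin (p+1))) : Fin (p+1) → ℤ :=
  fun i => X i - if i ∈ M then 1 else 0

lemma ent_summable (hf : Good f v lam) (L : ℤ) (hL : (p:ℤ) + 1 < L) (X Y : Fin (p+1) → ℤ) (t : ℕ) :
    Summable fun n => sg p n * (ent f L X Y t n).det := by
  have := mix_summable hf L hL X Y t ∅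
  convert this using 4
  ext i j; simp [mix]

lemma Phi_expand (hf : Good f v lam) (L : ℤ) (hL : (p:ℤ) + 1 < L) (X Y : Fin (p+1) → ℤ) (t : ℕ) :
    Phi f L X Y t {i | fst L X i} = ∑ M, cf L v X M * FF f L (Xs X M) Y t := by
  have h1 : ∀ n, (mix f L X Y t {i | fst L X i} n).det =
      ∑ M, cf L v X M * (ent f L (Xs X M) Y t n).det := by
    intro n
    let D : Matrix (Fin (p+1)) (Fin (p+1)) ℂ := Matrix.of fun i j => (if fst L X i then v else 0) *
      ent f L (fun i => X i - 1) Y t n i j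
    let E : Matrix (Fin (p+1)) (Fin (p+1)) ℂ := Matrix.of fun i j => (if fst L X i then 1 - v else 1) *
      ent f L X Y t n i j
    have e : mix f L X Y t {i | fst L X i} n = D + E := by
      ext i j
      simp only [mix, ent, Matrix.of_apply, Matrix.add_apply, D, E, Set.mem_ofPred_eq]
      split_ifs
      · rw [hf.ev, add_comm]
        congr 3; ring
      · simp
    rw [e]
    have := (Matrix.detRowAlternating (n := Fin (p+1)) (R := ℂ)).toMultilinearMap.map_add_univ D E
    refine this.trans (Finset.sum_congr rfl fun M _ => ?_)
    have h2 : M.piecewise D E = fun i => (if i ∈ M then (if fst L X i then v else 0) else (if fst L X i then 1 - v else 1)) • (ent f L (Xs X M) Y t n) i := by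
      ext i j
      by_cases hi : i ∈ M <;> simp [Finset.piecewise, hi, D, E, ent, Xs]
    rw [h2]
    exact (Matrix.detRowAlternating (n := Fin (p+1)) (R := ℂ)).toMultilinearMap.map_smul_univ _ _
  unfold Phi FF
  simp only [h1, ← tsum_mul_left]
  rw [← Summable.tsum_finsetSum]
  · congr 1; ext n
    rw [Finset.mul_sum]
    refine Finset.sum_congr rfl fun M _ => by ring
  · intro M _
    exact (ent_summable hf L hL _ Y t).mul_left _

lemma star_rot (L : ℤ) (X Y : Fin (p+1) → ℤ) (t : ℕ) :
    ∑ M, cf L v (rotX L X) M * FF f L (Xs (rotX L X) M) Y t = ∑ M, cf L v X M * FF f L (Xs X M) Y t := by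
  let e : Finset (Fin (p+1)) ≃ Finset (Fin (p+1)) := (Equiv.addRight (1 : Fin (p+1))).finsetCongr
  have he : ∀ M i, i + 1 ∈ e M ↔ i ∈ M := by
    intro M i
    simp [e, Equiv.finsetCongr_apply]
  rw [← e.sum_comp (fun M => cf L v X M * FF f L (Xs X M) Y t)]
  refine Finset.sum_congr rfl fun M _ => ?_
  congr 1
  · unfold cf
    rw [← Equiv.prod_comp (Equiv.addRight (1 : Fin (p+1))) (fun i => if i ∈ e M then (if fst L X i then v else 0) else (if fst L X i then 1 - v else 1))]
    refine Finset.prod_congr rfl fun i _ => ?_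
    simp only [Equiv.coe_addRight, he, fst_rot]
    by_cases h1 : i ∈ M <;> by_cases h2 : fst L X (i + 1) <;> simp [h1, h2]
  · rw [← FF_rot L (Xs X (e M))]
    congr 1
    ext i
    simp only [Xs, rotX, he]
    ring

lemma star (hf : Good f v lam) (L : ℤ) (hL : (p:ℤ) + 1 < L) (Y : Fin (p+1) → ℤ) (t : ℕ)
    (k : ℕ) (hk : k < p + 1) : ∀ (X : Fin (p+1) → ℤ), fst L X ⟨k, hk⟩ →
    FF f L X Y (t+1) = ∑ M, cf L v X M * FF f L (Xs X M) Y t := by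
  induction k with
  | zero =>
    intro X h
    rw [← Phi_expand hf L hL, ← Phi_chain hf L hL X Y t h (p+1) le_rfl]
    unfold FF Phi
    congr 1; ext n; congr 2
    ext i j
    have : (i:ℕ) < p + 1 := i.2
    simp only [mix, Matrix.of_apply, Set.mem_ofPred_eq, this, true_or, if_true]
  | succ k ih =>
    intro X h
    rw [← FF_rot, ← star_rot]
    apply ih (by omega)
    rw [fst_rot]
    convert h using 1
    ext
    rw [Fin.val_add_one_of_lt]
    rw [Fin.lt_def]; simp; omega

end alg2

section alg3
variable {p : ℕ} {f : ℤ → ℤ → ℕ → ℂ} {v lam : ℂ}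

lemma Good.nz (hf : Good f v lam) {a b : ℤ} (h : f a b 0 ≠ 0) :
    (0 ≤ a → b ≤ a) ∧ (a ≤ 0 → a ≤ b) := by
  constructor
  · intro ha; by_contra hc
    exact h (hf.z1 _ _ _ (by simpa using ha) (by simpa using hc))
  · intro ha; by_contra hc
    exact h (hf.z2 _ _ _ ha (by simpa using hc))

lemma Good.dpos (hf : Good f v lam) (a : ℕ) : f a a 0 = lam ^ a := by
  induction a with
  | zero => simpa using hf.one
  | succ a ih =>
    have h := hf.bd a (a+1) 0
    have h1 : f ((a:ℤ)+1) (a+1+1) 0 = 0 := hf.z1 _ _ _ (by simp; omega) (by simp)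
    have h2 : f (a:ℤ) (a+1) 0 = 0 := hf.z1 _ _ _ (by simp) (by simp)
    rw [h1, h2, add_sub_cancel_right, ih] at h
    push_cast
    rw [pow_succ]
    linear_combination h

lemma Good.dneg (hf : Good f v lam) (a : ℕ) : f (-a) (-a) 0 = (-1) ^ a := by
  induction a with
  | zero => simpa using hf.one
  | succ a ih =>
    have h := hf.bd (-(a+1)) (-(a+1)) 0
    have h1 : f (-((a:ℤ)+1)+1) (-(a+1)) 0 = 0 := hf.z2 _ _ _ (by omega) (by omega)
    have h2 : f (-((a:ℤ)+1)) (-(a+1)-1) 0 = 0 := hf.z2 _ _ _ (by omega) (by omega)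
    rw [h1, h2, show -((a:ℤ)+1)+1 = -a by ring, ih] at h
    push_cast
    rw [pow_succ]
    linear_combination -h

lemma Good.dposz (hf : Good f v lam) (a : ℤ) (h : 0 ≤ a) : f a a 0 = lam ^ a.toNat := by
  obtain ⟨n, rfl⟩ := Int.eq_ofNat_of_zero_le h
  simpa using hf.dpos n

lemma Good.dnegz (hf : Good f v lam) (a : ℤ) (h : a ≤ 0) : f a a 0 = (-1) ^ (-a).toNat := by
  obtain ⟨n, hn⟩ := Int.eq_ofNat_of_zero_le (a := -a) (by omega)
  have : a = -n := by omega
  subst this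
  simpa using hf.dneg n

lemma det_perm_ne (D : Matrix (Fin (p+1)) (Fin (p+1)) ℂ) (h : D.det ≠ 0) :
    ∃ σ : Equiv.Perm (Fin (p+1)), ∀ j, D (σ j) j ≠ 0 := by
  rw [Matrix.det_apply] at h
  obtain ⟨σ, -, hσ⟩ := Finset.exists_ne_zero_of_sum_ne_zero h
  refine ⟨σ, fun i hi => hσ ?_⟩
  rw [Finset.prod_eq_zero (f := fun i => D (σ i) i) (Finset.mem_univ i) hi, smul_zero]

lemma inj_ge (M : Fin (p+1) → ℤ) (hM : Function.Injective M) (hp : ∀ i, M i ≤ p)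
    (hs : ∑ i, M i = ∑ i : Fin (p+1), ((i : ℕ) : ℤ)) : ∀ i, 0 ≤ M i := by
  set s := Finset.univ.image M with hsd
  set t := Finset.univ.image (fun i : Fin (p+1) => ((i:ℕ):ℤ)) with htd
  have hinj : Function.Injective (fun i : Fin (p+1) => ((i:ℕ):ℤ)) := by
    intro i j h
    have h' : ((i:ℕ):ℤ) = ((j:ℕ):ℤ) := h
    ext; exact_mod_cast h'
  have cs : s.card = p + 1 := by rw [hsd, Finset.card_image_of_injective _ hM]; simp
  have ct : t.card = p + 1 := by rw [htd, Finset.card_image_of_injective _ hinj]; simp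
  have ss : ∑ x ∈ s, x = ∑ i, M i := by rw [hsd, Finset.sum_image (fun _ _ _ _ h => hM h)]
  have st : ∑ x ∈ t, x = ∑ i : Fin (p+1), ((i : ℕ) : ℤ) := by
    rw [htd, Finset.sum_image (fun _ _ _ _ h => hinj h)]
  have e : ∑ x ∈ s \ t, x = ∑ x ∈ t \ s, x := by
    have h1 := Finset.sum_inter_add_sum_sdiff s t (fun x => x)
    have h2 := Finset.sum_inter_add_sum_sdiff t s (fun x => x)
    rw [Finset.inter_comm] at h2
    omega
  have h1 : ∀ x ∈ s \ t, x ≤ -1 := by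
    intro x hx
    simp only [Finset.mem_sdiff, s, t, Finset.mem_image, Finset.mem_univ, true_and, not_exists] at hx
    obtain ⟨⟨i, rfl⟩, h⟩ := hx
    by_contra hc
    have := hp i
    exact h ⟨(M i).toNat, by omega⟩ (by simp; omega)
  have h2 : 0 ≤ ∑ x ∈ t \ s, x := by
    apply Finset.sum_nonneg
    intro x hx
    simp only [Finset.mem_sdiff, t, Finset.mem_image, Finset.mem_univ, true_and] at hx
    obtain ⟨⟨i, rfl⟩, -⟩ := hx
    positivity
  have h3 : ∑ x ∈ s \ t, x ≤ (s \ t).card • (-1 : ℤ) := Finset.sum_le_card_nsmul _ _ _ h1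
  have h4 : (s \ t).card = 0 := by simp at h3; omega
  intro i
  rw [Finset.card_eq_zero, Finset.sdiff_eq_empty_iff_subset] at h4
  have := h4 (Finset.mem_image_of_mem M (Finset.mem_univ i))
  simp only [t, Finset.mem_image, Finset.mem_univ, true_and] at this
  obtain ⟨k, hk⟩ := this
  rw [← hk]; positivity

lemma inj_le (M : Fin (p+1) → ℤ) (hM : Function.Injective M) (hp : ∀ i, 0 ≤ M i)
    (hs : ∑ i, M i = ∑ i : Fin (p+1), ((i : ℕ) : ℤ)) : ∀ i, M i ≤ p := by
  have hr : ∑ i : Fin (p+1), ((p:ℤ) - ((i : ℕ) : ℤ)) = ∑ i : Fin (p+1), ((i : ℕ) : ℤ) := by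
    rw [← Equiv.sum_comp Fin.revPerm]
    refine Finset.sum_congr rfl fun i _ => ?_
    have := i.2
    simp [Fin.val_rev]; omega
  have := inj_ge (fun i => (p:ℤ) - M i) (fun i j h => hM (by simpa using h))
    (fun i => by have := hp i; omega)
    (by
      rw [← hr, Finset.sum_sub_distrib, Finset.sum_sub_distrib, hs])
  intro i; have := this i; omega

/-- case A -/
lemma caseA (D : Matrix (Fin (p+1)) (Fin (p+1)) ℂ) (M U w : Fin (p+1) → ℤ)
    (hD : ∀ i j, D i j ≠ 0 → (((j:ℕ):ℤ) ≤ M i → U i ≤ w j) ∧ (M i ≤ ((j:ℕ):ℤ) → w j ≤ U i))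
    (hM : Function.Injective M) (hw : Monotone w) (hMU : ∀ i k, M i ≤ M k → U i ≤ U k)
    (h0 : ∀ i, 0 ≤ M i) (hp : ∀ i, M i ≤ p) (hdet : D.det ≠ 0)
    (i m : Fin (p+1)) (him : M i = ((m:ℕ):ℤ)) : U i = w m := by
  obtain ⟨σ, hσ⟩ := det_perm_ne D hdet
  have hinj : Function.Injective (fun j => M (σ j)) := hM.comp σ.injective
  rcases lt_trichotomy (U i) (w m) with h | h | h
  · exfalso
    have key : ∀ j ∈ Finset.Ici m, M (σ j) ∈ Finset.Ioc ((m:ℕ):ℤ) p := by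
      intro j hj
      rw [Finset.mem_Ici] at hj
      have hj' : (m:ℕ) ≤ j := hj
      rw [Finset.mem_Ioc]
      refine ⟨?_, hp _⟩
      by_contra hc
      have h1 := (hD _ _ (hσ j)).2 (by omega)
      have h2 := hMU (σ j) i (by omega)
      have h3 := hw hj
      omega
    have := Finset.card_le_card_of_injOn _ key (hinj.injOn)
    simp at this
    have := m.2
    omega
  · exact h
  · exfalso
    have key : ∀ j ∈ Finset.Iic m, M (σ j) ∈ Finset.Ico (0:ℤ) (m:ℕ) := by
      intro j hj
      rw [Finset.mem_Iic] at hj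
      have hj' : (j:ℕ) ≤ m := hj
      rw [Finset.mem_Ico]
      refine ⟨h0 _, ?_⟩
      by_contra hc
      have h1 := (hD _ _ (hσ j)).1 (by omega)
      have h2 := hMU i (σ j) (by omega)
      have h3 := hw hj
      omega
    have := Finset.card_le_card_of_injOn _ key (hinj.injOn)
    simp at this

lemma det_zero_prop (D : Matrix (Fin (p+1)) (Fin (p+1)) ℂ) (i k : Fin (p+1)) (hik : i ≠ k) (c : ℂ)
    (h : ∀ j, D i j = c * D k j) : D.det = 0 := by
  have : D = D.updateRow i (c • D k) := by
    ext a b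
    by_cases ha : a = i
    · subst ha; simp [h]
    · simp [Matrix.updateRow_ne ha]
  rw [this, Matrix.det_updateRow_smul]
  rw [Matrix.det_zero_of_row_eq hik, mul_zero]
  ext b
  rw [Matrix.updateRow_self, Matrix.updateRow_ne hik.symm]

lemma ent_MU (L : ℤ) (X Y n : Fin (p+1) → ℤ) (t : ℕ) (i j : Fin (p+1)) :
    ent f L X Y t n i j =
      f (((i:ℕ):ℤ) + (p+1) * n i - ∑ k, n k - (j:ℕ))
        (((i:ℕ):ℤ) + (p+1) * n i - ∑ k, n k - (j:ℕ) +
          ((X i - (i:ℕ) + n i * (L - (p+1)) + ∑ k, n k) - (Y j - (j:ℕ)))) t := by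
  simp only [ent, Matrix.of_apply]
  congr 1 <;> push_cast <;> ring

def Cfg (L : ℤ) (X : Fin (p+1) → ℤ) : Prop := StrictMono X ∧ ∀ i, 1 ≤ X i ∧ X i ≤ L

lemma Cfg.mono {L : ℤ} {X : Fin (p+1) → ℤ} (h : Cfg L X) {i j : Fin (p+1)} (hij : i ≤ j) :
    X i - (i:ℕ) ≤ X j - (j:ℕ) := by
  have : Monotone fun i : Fin (p+1) => X i - ((i:ℕ):ℤ) := by
    rw [Fin.monotone_iff_le_succ]
    intro i
    have := h.1 (Fin.castSucc_lt_succ (i := i))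
    simp
    omega
  exact this hij

lemma Cfg.lb {L : ℤ} {X : Fin (p+1) → ℤ} (h : Cfg L X) (i : Fin (p+1)) :
    1 ≤ X i - (i:ℕ) := by
  have h1 := h.mono (Fin.zero_le i)
  have := (h.2 0).1
  simp at h1; omega

lemma Cfg.ub {L : ℤ} {X : Fin (p+1) → ℤ} (h : Cfg L X) (i : Fin (p+1)) :
    X i - (i:ℕ) ≤ L - p := by
  have h1 := h.mono (Fin.le_last i)
  have := (h.2 (Fin.last p)).2
  simp at h1; omega

def nst (p : ℕ) : Fin (p+1) → ℤ := fun i => if i = 0 then 1 else if i = Fin.last p then -1 else 0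

lemma MU_mono {L : ℤ} {X : Fin (p+1) → ℤ} (h : Cfg L X) (hL : (p:ℤ)+1 < L) (n : Fin (p+1) → ℤ) (N c : ℤ)
    (i k : Fin (p+1))
    (hM : ((i:ℕ):ℤ) + (p+1) * n i - N + (p+1) * c ≤ ((k:ℕ):ℤ) + (p+1) * n k - N) :
    (X i - (i:ℕ) + n i * (L - (p+1)) + N) + (L - (p+1)) * c ≤ X k - (k:ℕ) + n k * (L - (p+1)) + N := by
  have hi := i.2
  have hk := k.2
  have h1 : n i + c ≤ n k := by
    by_contra hc
    have : n k + 1 ≤ n i + c := by omega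
    nlinarith
  rcases eq_or_lt_of_le h1 with h2 | h2
  · have h3 : i ≤ k := by
      rw [Fin.le_def]
      rw [← h2] at hM
      have : ((i:ℕ):ℤ) ≤ (k:ℕ) := by linarith
      omega
    have := h.mono h3
    rw [← h2]; linarith
  · have e1 := h.ub i
    have e2 := h.lb k
    have : n i + c + 1 ≤ n k := by omega
    have : (n i + c + 1) * (L - (p+1)) ≤ n k * (L - (p+1)) :=
      mul_le_mul_of_nonneg_right this (by omega)
    linarith

lemma M_inj (n : Fin (p+1) → ℤ) (N : ℤ) (i k : Fin (p+1)) (c : ℤ)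
    (h : ((i:ℕ):ℤ) + (p+1) * n i - N = ((k:ℕ):ℤ) + (p+1) * n k - N + (p+1) * c) : i = k := by
  have hi := i.2
  have hk := k.2
  have h1 : n i = n k + c := by
    rcases lt_trichotomy (n i) (n k + c) with h1 | h1 | h1
    · have : n i + 1 ≤ n k + c := by omega
      nlinarith
    · exact h1
    · have : n k + c + 1 ≤ n i := by omega
      nlinarith
  rw [h1] at h
  ext
  have : ((i:ℕ):ℤ) = (k:ℕ) := by linarith
  omega

set_option maxHeartbeats 2000000 in
lemma classify (hf : Good f v lam) (L : ℤ) (hL : (p:ℤ) + 1 < L) (X Y n : Fin (p+1) → ℤ)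
    (hX : Cfg L X) (hY : Cfg L Y) (hdet : (ent f L X Y 0 n).det ≠ 0) :
    (n = 0 ∧ X = Y) ∨ (n = nst p ∧ 1 ≤ p ∧ X 0 = 1 ∧ Y 0 = 1 ∧ X (Fin.last p) = L ∧ Y (Fin.last p) = L) := by
  set D := ent f L X Y 0 n with hDd
  set N := ∑ k, n k with hN
  set H := L - (p+1) with hH
  have hH1 : 1 ≤ H := by omega
  let M : Fin (p+1) → ℤ := fun i => ((i:ℕ):ℤ) + (p+1) * n i - N
  let U : Fin (p+1) → ℤ := fun i => X i - (i:ℕ) + n i * H + N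
  let w : Fin (p+1) → ℤ := fun i => Y i - (i:ℕ)
  have hMd : ∀ i, M i = ((i:ℕ):ℤ) + (p+1) * n i - N := fun _ => rfl
  have hUd : ∀ i, U i = X i - (i:ℕ) + n i * H + N := fun _ => rfl
  have hDe : ∀ i j, D i j = f (M i - (j:ℕ)) (M i - (j:ℕ) + (U i - w j)) 0 := by
    intro i j; exact ent_MU L X Y n 0 i j
  have hD : ∀ i j, D i j ≠ 0 → (((j:ℕ):ℤ) ≤ M i → U i ≤ w j) ∧ (M i ≤ ((j:ℕ):ℤ) → w j ≤ U i) := by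
    intro i j h
    rw [hDe] at h
    obtain ⟨h1, h2⟩ := hf.nz h
    constructor <;> intro h <;> omega
  have hMU : ∀ c i k, M i + (p+1) * c ≤ M k → U i + H * c ≤ U k := by
    intro c i k h
    exact MU_mono hX hL n N c i k h
  have hMi : ∀ c i k, M i = M k + (p+1) * c → i = k := by
    intro c i k h; exact M_inj n N i k c h
  have hinj : Function.Injective M := by
    intro i k h; exact hMi 0 i k (by omega)
  have hMU0 : ∀ i k, M i ≤ M k → U i ≤ U k := by
    intro i k h; have := hMU 0 i k (by omega); omega
  have hMU1 : ∀ i k, M i + (p+1) ≤ M k → U i + H ≤ U k := by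
    intro i k h; have := hMU 1 i k (by omega); omega
  have hw : Monotone w := fun i j h => hY.mono h
  have hwl : ∀ j, 1 ≤ w j := hY.lb
  have hwu : ∀ j, w j ≤ H + 1 := by intro j; have h1 : w j ≤ L - p := hY.ub j
                                    omega
  have hsum : ∑ i, M i = ∑ i : Fin (p+1), ((i : ℕ) : ℤ) := by
    simp only [M, Finset.sum_sub_distrib, Finset.sum_add_distrib, ← Finset.mul_sum, ← hN]
    simp
  have hrow : ∀ i, ∃ j, D i j ≠ 0 := by
    intro i; by_contra hc; push Not at hc
    exact hdet (Matrix.det_eq_zero_of_row_eq_zero i hc)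
  have hjb : ∀ j : Fin (p+1), 0 ≤ ((j:ℕ):ℤ) ∧ ((j:ℕ):ℤ) ≤ p := by
    intro j; have := j.2; omega
  by_cases hA : (∀ i, 0 ≤ M i) ∧ (∀ i, M i ≤ p)
  · left
    have key : ∀ i m : Fin (p+1), M i = ((m:ℕ):ℤ) → U i = w m :=
      fun i m => caseA D M U w hD hinj hw hMU0 hA.1 hA.2 hdet i m
    have key2 : ∀ i m : Fin (p+1), M i = ((m:ℕ):ℤ) → n i = 0 ∧ X i = Y m := by
      intro i m h
      have h1 := key i m h
      have h2 : X i + n i * L = Y m := by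
        have e : U i + M i = X i + n i * L := by rw [hMd, hUd, hH]; ring
        have e2 : w m = Y m - (m:ℕ) := rfl
        omega
      have a1 := hX.2 i
      have a2 := hY.2 m
      have : n i = 0 := by
        rcases lt_trichotomy (n i) 0 with h | h | h
        · have : n i + 1 ≤ 0 := by omega
          nlinarith
        · exact h
        · have : 1 ≤ n i := by omega
          nlinarith
      rw [this] at h2
      exact ⟨this, by omega⟩
    have hn : n = 0 := by
      ext i
      have b0 := hA.1 i
      have b1 := hA.2 i
      exact (key2 i ⟨(M i).toNat, by omega⟩ (by simp; omega)).1
    refine ⟨hn, ?_⟩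
    ext i
    refine (key2 i i ?_).2
    rw [hMd, hN, hn]; simp
  · right
    have hA1 : ∃ a, (p:ℤ) + 1 ≤ M a := by
      by_contra hc; push Not at hc
      have h1 : ∀ i, M i ≤ p := fun i => by have := hc i; omega
      exact hA ⟨inj_ge M hinj h1 hsum, h1⟩
    have hA2 : ∃ b, M b ≤ -1 := by
      by_contra hc; push Not at hc
      have h1 : ∀ i, 0 ≤ M i := fun i => by have := hc i; omega
      exact hA ⟨h1, inj_le M hinj h1 hsum⟩
    obtain ⟨a, ha⟩ := hA1
    obtain ⟨b, hb⟩ := hA2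
    have hi1 : ∀ i, (p:ℤ) ≤ M i → U i ≤ w (Fin.last p) := by
      intro i hi
      obtain ⟨j, hj⟩ := hrow i
      have h1 := (hD i j hj).1 (by have := hjb j; omega)
      exact h1.trans (hw (Fin.le_last j))
    have lo1 : ∀ i, M i ≤ 0 → w 0 ≤ U i := by
      intro i hi
      obtain ⟨j, hj⟩ := hrow i
      have h1 := (hD i j hj).2 (by have := hjb j; omega)
      exact (hw (Fin.zero_le j)).trans h1
    have q1 := hi1 a (by omega)
    have q2 := lo1 b (by omega)
    have q3 := hwu (Fin.last p)
    have q4 := hwl 0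
    have hi2 : ∀ i, (p:ℤ) ≤ M i → U i = H + 1 := by
      intro i hi
      have h1 := hi1 i hi
      have h2 := hMU1 b i (by omega)
      omega
    have lo2 : ∀ i, M i ≤ 0 → U i = 1 := by
      intro i hi
      have h1 := lo1 i hi
      have h2 := hMU1 i a (by omega)
      omega
    have Ua := hi2 a (by omega)
    have Ub := lo2 b (by omega)
    have hi3 : ∀ i, (p:ℤ) ≤ M i → ∀ j, D i j = if w j = H + 1 then lam ^ (M i - (j:ℕ)).toNat else 0 := by
      intro i hi j
      have h1 := hi2 i hi
      have h2 := hjb j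
      split_ifs with h
      · rw [hDe, h1, h, sub_self, add_zero]
        exact hf.dposz _ (by omega)
      · by_contra hc
        have := (hD i j hc).1 (by omega)
        have := hwu j
        omega
    have lo3 : ∀ i, M i ≤ 0 → ∀ j, D i j = if w j = 1 then (-1) ^ (-(M i - (j:ℕ))).toNat else 0 := by
      intro i hi j
      have h1 := lo2 i hi
      have h2 := hjb j
      split_ifs with h
      · rw [hDe, h1, h, sub_self, add_zero]
        exact hf.dnegz _ (by omega)
      · by_contra hc
        have := (hD i j hc).2 (by omega)
        have := hwl j
        omega
    have hi4 : ∀ i k, (p:ℤ) ≤ M i → M i ≤ M k → i = k := by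
      intro i k h1 h2
      by_contra hne
      apply hdet
      refine det_zero_prop D k i (Ne.symm hne) (lam ^ (M k - M i).toNat) fun j => ?_
      rw [hi3 i h1, hi3 k (by omega)]
      have h3 := hjb j
      split_ifs
      · rw [← pow_add]; congr 1; omega
      · simp
    have lo4 : ∀ i k, M i ≤ 0 → M k ≤ M i → i = k := by
      intro i k h1 h2
      by_contra hne
      apply hdet
      refine det_zero_prop D k i (Ne.symm hne) ((-1) ^ (M i - M k).toNat) fun j => ?_
      rw [lo3 i h1, lo3 k (by omega)]
      have h3 := hjb j
      split_ifs
      · rw [← pow_add]; congr 1; omega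
      · simp
    have hi5 : ∀ i, (p:ℤ) ≤ M i → i = a := by
      intro i h
      rcases le_total (M i) (M a) with h1 | h1
      · exact hi4 i a h h1
      · exact (hi4 a i (by omega) h1).symm
    have lo5 : ∀ i, M i ≤ 0 → i = b := by
      intro i h
      rcases le_total (M b) (M i) with h1 | h1
      · exact lo4 i b h h1
      · exact (lo4 b i (by omega) h1).symm
    have hab : a ≠ b := by rintro rfl; omega
    have hdiff : M a < M b + (p+1) * 2 := by
      by_contra hc
      have := hMU 2 b a (by omega)
      omega
    have hres : ∀ c : ℤ, ∃ i d, M i = c + (p+1) * d := by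
      intro c
      have h1 : 0 ≤ (N + c) % (p+1) := Int.emod_nonneg _ (by omega)
      have h2 : (N + c) % (p+1) < p+1 := Int.emod_lt_of_pos _ (by omega)
      have h3 := Int.emod_add_mul_ediv (N + c) (p+1)
      refine ⟨⟨((N + c) % (p+1)).toNat, by omega⟩, n ⟨((N + c) % (p+1)).toNat, by omega⟩ - (N + c) / (p+1), ?_⟩
      rw [hMd]
      simp only [Int.toNat_of_nonneg h1]
      linarith
    have hp1 : 1 ≤ p := by
      by_contra hc
      have : p = 0 := by omega
      subst this
      exact hab (Fin.ext (by omega))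
    have Ma : M a = p + 1 := by
      obtain ⟨i, d, hi⟩ := hres 0
      by_cases c1 : (p:ℤ) ≤ M i
      · have := hi5 i c1
        subst this
        have d1 : d < 2 := by by_contra hc; nlinarith
        have d2 : 0 < d := by by_contra hc; nlinarith
        have : d = 1 := by omega
        rw [this] at hi; omega
      · exfalso
        by_cases c2 : M i ≤ 0
        · have := lo5 i c2
          subst this
          have d1 : d < 0 := by by_contra hc; nlinarith
          have d2 : -1 < d := by
            by_contra hc
            have : d ≤ -1 := by omega
            nlinarith
          omega
        · have d1 : d < 1 := by by_contra hc; nlinarith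
          have d2 : 0 < d := by by_contra hc; nlinarith
          omega
    have Mb : M b = -1 := by
      obtain ⟨i, d, hi⟩ := hres (-1)
      by_cases c1 : (p:ℤ) ≤ M i
      · exfalso
        have := hi5 i c1
        subst this
        have d1 : d < 2 := by by_contra hc; nlinarith
        have d2 : 1 < d := by by_contra hc; nlinarith
        omega
      · by_cases c2 : M i ≤ 0
        · have := lo5 i c2
          subst this
          have d1 : d < 1 := by by_contra hc; nlinarith
          have d2 : -1 < d := by
            by_contra hc
            have : d ≤ -1 := by omega
            nlinarith
          have : d = 0 := by omega
          rw [this] at hi; omega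
        · exfalso
          have d1 : d < 1 := by by_contra hc; nlinarith
          have d2 : 0 < d := by by_contra hc; nlinarith
          omega
    have eqn : ∀ i, U i + M i = X i + n i * L := by intro i; rw [hMd, hUd, hH]; ring
    have Xa : X a = 1 ∧ n a = 1 := by
      have e := eqn a
      have h1 := hX.2 a
      rw [Ua, Ma] at e
      have d1 : n a < 2 := by
        by_contra hc
        have : 2 ≤ n a := by omega
        nlinarith
      have d2 : 0 < n a := by by_contra hc; nlinarith
      have : n a = 1 := by omega
      rw [this] at e
      exact ⟨by omega, this⟩
    have Xb : X b = L ∧ n b = -1 := by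
      have e := eqn b
      have h1 := hX.2 b
      rw [Ub, Mb] at e
      have d1 : n b < 0 := by
        by_contra hc
        nlinarith
      have d2 : -2 < n b := by
        by_contra hc
        have : n b ≤ -2 := by omega
        nlinarith
      have : n b = -1 := by omega
      rw [this] at e
      exact ⟨by omega, this⟩
    have a0 : a = 0 := by
      by_contra hc
      have := hX.1 (Fin.pos_of_ne_zero hc)
      have := (hX.2 0).1
      omega
    have bl : b = Fin.last p := by
      by_contra hc
      have := hX.1 (Fin.lt_last_iff_ne_last.mpr hc)
      have := (hX.2 (Fin.last p)).2
      omega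
    have N0 : N = 0 := by
      have := hMd a
      rw [Ma, Xa.2, a0] at this
      simp at this; omega
    refine ⟨?_, hp1, a0 ▸ Xa.1, ?_, bl ▸ Xb.1, ?_⟩
    · ext i
      unfold nst
      split_ifs with c1 c2
      · rw [c1, ← a0]; exact Xa.2
      · rw [c2, ← bl]; exact Xb.2
      · have h1 : ¬ (p:ℤ) ≤ M i := fun h => c1 ((hi5 i h).trans a0)
        have h2 : ¬ M i ≤ 0 := fun h => c2 ((lo5 i h).trans bl)
        have h3 := hMd i
        have h4 := hjb i
        rw [N0] at h3
        have d1 : n i < 1 := by by_contra hc; nlinarith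
        have d2 : -1 < n i := by
          by_contra hc
          have : n i ≤ -1 := by omega
          nlinarith
        omega
    · have : w 0 = Y 0 - ((0 : Fin (p+1)):ℕ) := rfl
      simp at this; omega
    · have : w (Fin.last p) = Y (Fin.last p) - ((Fin.last p : Fin (p+1)):ℕ) := rfl
      simp at this; omega

end alg3

section alg4
variable {p : ℕ} {f : ℤ → ℤ → ℕ → ℂ} {v lam : ℂ}

lemma ent0_val (hf : Good f v lam) (L : ℤ) (X : Fin (p+1) → ℤ) (hX : Cfg L X) (i j : Fin (p+1)) :
    ent f L X X 0 0 i j = if X i - (i:ℕ) = X j - (j:ℕ) then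
      (if j ≤ i then lam ^ ((i:ℕ) - (j:ℕ)) else (-1) ^ ((j:ℕ) - (i:ℕ))) else 0 := by
  rw [ent_MU]
  simp only [Pi.zero_apply, mul_zero, Finset.sum_const_zero, sub_zero, add_zero, zero_mul]
  split_ifs with h1 h2
  · have h2' : (j:ℕ) ≤ i := h2
    rw [h1, sub_self, add_zero, hf.dposz _ (by omega)]
    congr 1; omega
  · have h2' : ¬ (j:ℕ) ≤ i := h2
    rw [h1, sub_self, add_zero, hf.dnegz _ (by omega)]
    congr 1; omega
  · by_contra hc
    obtain ⟨a1, a2⟩ := hf.nz hc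
    rcases le_total i j with h | h
    · have := hX.mono h
      have h' : (i:ℕ) ≤ j := h
      have := a2 (by omega)
      omega
    · have := hX.mono h
      have h' : (j:ℕ) ≤ i := h
      have := a1 (by omega)
      omega

lemma det0 (hf : Good f v lam) (L : ℤ) (X : Fin (p+1) → ℤ) (hX : Cfg L X) :
    (ent f L X X 0 0).det = ∏ i : Fin p, if X i.succ = X i.castSucc + 1 then 1 + lam else 1 := by
  let c : Fin p → ℂ := fun i => if X i.succ = X i.castSucc + 1 then lam else 0
  let A := ent f L X X 0 0
  let B : Matrix (Fin (p+1)) (Fin (p+1)) ℂ := Matrix.of fun i j =>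
    Fin.cases (A 0 j) (fun i => A i.succ j - c i * A i.castSucc j) i
  have hB0 : ∀ j, B 0 j = A 0 j := fun j => rfl
  have hBs : ∀ i j, B (Fin.succ i) j = A i.succ j - c i * A i.castSucc j := fun i j => rfl
  have h1 : A.det = B.det := by
    refine Matrix.det_eq_of_forall_row_eq_smul_add_pred c (fun j => ?_) (fun i j => ?_)
    · rw [hB0]
    · rw [hBs]; ring
  have hA : ∀ i j, A i j = _ := fun i j => ent0_val hf L X hX i j
  have hs : ∀ (i : Fin p) (j : Fin (p+1)), j ≤ i.castSucc → B i.succ j = 0 := by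
    intro i j hj
    have hj1 : j ≤ i.succ := hj.trans (Fin.castSucc_lt_succ).le
    have hj' : (j:ℕ) ≤ i := hj
    rw [hBs, hA, hA]
    simp only [hj, hj1, if_true, c]
    have h2 := hX.1 (Fin.castSucc_lt_succ (i := i))
    have h3 := hX.mono hj
    simp only [Fin.val_succ, Fin.val_castSucc] at *
    by_cases h4 : X i.succ = X i.castSucc + 1
    · simp only [h4, if_true]
      by_cases h5 : X i.castSucc - (i:ℕ) = X j - (j:ℕ)
      · have h6 : X i.castSucc + 1 - ((i+1 : ℕ):ℤ) = X j - (j:ℕ) := by push_cast; omega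
        rw [if_pos h5, if_pos h6, show (i:ℕ) + 1 - j = (i - j) + 1 by omega, pow_succ]; ring
      · have h6 : ¬ X i.castSucc + 1 - ((i+1 : ℕ):ℤ) = X j - (j:ℕ) := by push_cast; omega
        rw [if_neg h5, if_neg h6]; ring
    · have h6 : ¬ X i.succ - ((i+1 : ℕ):ℤ) = X j - (j:ℕ) := by push_cast; omega
      simp only [h4, if_false, if_neg h6]; ring
  have htri : B.BlockTriangular id := by
    intro i j hij
    simp only [id] at hij
    induction i using Fin.cases with
    | zero => exact absurd hij (Fin.not_lt_zero _)
    | succ i => exact hs i j (Fin.le_castSucc_iff.mpr hij)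
  change A.det = _
  rw [h1, Matrix.det_of_isUpperTriangular htri, Fin.prod_univ_succ, hB0, hA]
  simp only [le_refl, if_true, Nat.sub_self, pow_zero, one_mul]
  refine Finset.prod_congr rfl fun i _ => ?_
  rw [hBs, hA, hA]
  have h9 : ¬ i.succ ≤ i.castSucc := not_le.mpr Fin.castSucc_lt_succ
  simp only [le_refl, if_true, Nat.sub_self, pow_zero, h9, if_false, c]
  simp only [Fin.val_succ, Fin.val_castSucc]
  by_cases h4 : X i.succ = X i.castSucc + 1
  · have : X i.castSucc - (i:ℕ) = X i.castSucc + 1 - ((i+1 : ℕ):ℤ) := by push_cast; ring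
    simp only [h4, if_true, if_pos this]
    simp
  · simp [h4]

lemma det_nst (hf : Good f v lam) (L : ℤ) (X Y : Fin (p+1) → ℤ) (hX : Cfg L X) (hY : Cfg L Y)
    (hp : 1 ≤ p) (hX0 : X 0 = 1) (hXl : X (Fin.last p) = L) :
    (ent f L X Y 0 (nst p)).det = lam * (ent f L X Y 0 0).det ∧ ∑ k, nst p k = 0 := by
  have hne : (0 : Fin (p+1)) ≠ Fin.last p := by
    intro h; have := congrArg Fin.val h; simp at this; omega
  have hsum : ∑ k, nst p k = 0 := by
    have : ∀ k, nst p k = (if k = 0 then 1 else 0) - (if k = Fin.last p then 1 else 0) := by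
      intro k; unfold nst
      split_ifs with h1 h2 h2
      · exact absurd (h1.symm.trans h2) hne
      all_goals simp
    simp [this, Finset.sum_sub_distrib]
  refine ⟨?_, hsum⟩
  let c : Fin (p+1) → ℂ := fun i => if i = 0 then lam else if i = Fin.last p then -1 else 1
  have hc : ∏ i, c i = - lam := by
    have : ∀ k, c k = (if k = 0 then lam else 1) * (if k = Fin.last p then -1 else 1) := by
      intro k; simp only [c]
      split_ifs with h1 h2 h2
      · exact absurd (h1.symm.trans h2) hne
      all_goals simp
    simp only [this, Finset.prod_mul_distrib, Finset.prod_ite_eq', Finset.mem_univ, if_true]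
    ring
  have e : ent f L X Y 0 (nst p) = Matrix.of fun i j =>
      c i * ((ent f L X Y 0 0).submatrix (Equiv.swap 0 (Fin.last p)) id) i j := by
    ext i j
    have hj := j.2
    have w1 := hY.lb j
    have w2 := hY.ub j
    rw [Matrix.of_apply, Matrix.submatrix_apply, ent_MU, ent_MU, hsum]
    simp only [id, Pi.zero_apply, Finset.sum_const_zero, mul_zero, zero_mul, add_zero, sub_zero]
    by_cases h0 : i = 0
    · subst h0
      rw [Equiv.swap_apply_left]
      simp only [c, nst, if_true, hX0, hXl, Fin.val_zero, Fin.val_last]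
      by_cases hw : Y j - (j:ℕ) = L - p
      · rw [hw, show (1 - ((0:ℕ):ℤ) + 1 * (L - (p+1)) - (L - p)) = 0 by push_cast; ring,
          sub_self, add_zero, add_zero, hf.dposz _ (by omega), hf.dposz _ (by omega), ← pow_succ']
        congr 1; omega
      · rw [hf.z1 _ _ _ (by push_cast; omega) (by push_cast; omega),
          hf.z1 _ _ _ (by push_cast; omega) (by push_cast; omega), mul_zero]
    · by_cases h1 : i = Fin.last p
      · subst h1
        rw [Equiv.swap_apply_right]
        simp only [c, nst, if_true, hX0, hXl, Fin.val_zero, Fin.val_last, hne.symm, if_false]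
        by_cases hw : Y j - (j:ℕ) = 1
        · rw [hw, show (L - (p:ℤ) + -1 * (L - (p+1)) - 1) = 0 by ring,
            show (1 - ((0:ℕ):ℤ) - 1) = 0 by simp, add_zero, add_zero,
            hf.dnegz _ (by omega), hf.dnegz _ (by omega), ← pow_succ']
          congr 1; omega
        · rw [hf.z2 _ _ _ (by push_cast; omega) (by push_cast; omega),
            hf.z2 _ _ _ (by push_cast; omega) (by push_cast; omega), mul_zero]
      · rw [Equiv.swap_apply_of_ne_of_ne h0 h1]
        simp [c, nst, h0, h1]
  rw [e, Matrix.det_mul_column, hc, Matrix.det_permute, Equiv.Perm.sign_swap hne]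
  simp

lemma FF_zero (hf : Good f v lam) (L : ℤ) (hL : (p:ℤ) + 1 < L) (X Y : Fin (p+1) → ℤ)
    (hX : Cfg L X) (hY : Cfg L Y) :
    FF f L X Y 0 = if X = Y then ∏ i, (if fst L X i then 1 else 1 + lam) else 0 := by
  have hsg0 : sg p 0 = 1 := by simp [sg]
  unfold FF
  split_ifs with hXY
  · subst hXY
    have hd := det0 hf L X hX
    rw [Fin.prod_univ_succ]
    have h1 : ∀ i : Fin p, (if fst L X i.succ then (1:ℂ) else 1 + lam) =
        if X i.succ = X i.castSucc + 1 then 1 + lam else 1 := by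
      intro i
      have : i.succ - 1 = i.castSucc := by
        rw [sub_eq_iff_eq_add]; simp
      simp only [fst, this, Fin.succ_ne_zero, if_false, sub_zero]
      by_cases h : X i.succ = X i.castSucc + 1 <;> simp [h]
    simp only [h1]
    rw [← hd]
    have h0 : fst L X 0 ↔ ¬ (X 0 = 1 ∧ X (Fin.last p) = L) := by
      have : (0 : Fin (p+1)) - 1 = Fin.last p := by
        rw [sub_eq_iff_eq_add]; simp
      simp only [fst, this, if_true]
      have := hX.2 0
      have := hX.2 (Fin.last p)
      constructor <;> intro h <;> omega
    by_cases hc : X 0 = 1 ∧ X (Fin.last p) = L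
    · rw [if_neg (by rw [h0]; simpa using hc)]
      have hp : 1 ≤ p := by
        by_contra h
        have : p = 0 := by omega
        subst this
        have : (0 : Fin (0+1)) = Fin.last 0 := rfl
        rw [← this] at hc
        push_cast at hL; omega
      obtain ⟨e1, e2⟩ := det_nst hf L X X hX hX hp hc.1 hc.2
      have hne : (0 : Fin (p+1) → ℤ) ≠ nst p := by
        intro h; have := congrFun h 0; simp [nst] at this
      rw [tsum_eq_sum (s := {0, nst p}), Finset.sum_pair hne, e1, hsg0]
      · simp [sg, e2]; ring
      · intro n hn
        by_contra hc
        rcases classify hf L hL X X n hX hX (right_ne_zero_of_mul hc) with h | h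
        · exact hn (by simp [h.1])
        · exact hn (by simp [h.1])
    · rw [if_pos (by rw [h0]; exact hc), tsum_eq_single 0, hsg0]
      intro n hn
      by_contra hc'
      rcases classify hf L hL X X n hX hX (right_ne_zero_of_mul hc') with h | h
      · exact hn h.1
      · exact hc ⟨h.2.2.1, h.2.2.2.2.1⟩
  · have : ∀ n, sg p n * (ent f L X Y 0 n).det = 0 := by
      intro n
      by_contra hc
      rcases classify hf L hL X Y n hX hY (right_ne_zero_of_mul hc) with h | h
      · exact hXY h.2
      · obtain ⟨h1, hp, h2, h3, h4, h5⟩ := h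
        rw [h1, (det_nst hf L X Y hX hY hp h2 h4).1] at hc
        have h6 := right_ne_zero_of_mul (right_ne_zero_of_mul hc)
        rcases classify hf L hL X Y 0 hX hY h6 with h | h
        · exact hXY h.2
        · have := congrFun h.1 0; simp [nst] at this
    simp [this]

end alg4

section alg5
variable {p : ℕ}

lemma pred_lt {i : Fin (p+1)} (h : i ≠ 0) : i - 1 < i := by
  have := val_succ_cyc (i - 1)
  rw [sub_add_cancel] at this
  simp only [h, if_false] at this
  rw [Fin.lt_def]; omega

lemma le_pred {i j : Fin (p+1)} (h : i < j) : i ≤ j - 1 := by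
  have h0 : j ≠ 0 := by rintro rfl; exact absurd h (Fin.not_lt_zero _)
  have := val_succ_cyc (j - 1)
  rw [sub_add_cancel] at this
  simp only [h0, if_false] at this
  rw [Fin.lt_def] at h
  rw [Fin.le_def]; omega

lemma zero_sub_one : (0 : Fin (p+1)) - 1 = Fin.last p := by
  rw [sub_eq_iff_eq_add]; simp

lemma add_one_eq_zero {i : Fin (p+1)} : i + 1 = 0 ↔ i = Fin.last p := by
  rw [← zero_sub_one, eq_sub_iff_add_eq]

lemma lemA (R : Fin (p+1) → ℤ) (hR : StrictMono R) (M : Finset (Fin (p+1)))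
    (hM : ∀ i ∈ M, i ≠ 0 → R i ≠ R (i-1) + 1) :
    StrictMono (Xs R M) ∧ ∀ i ∈ M, ∀ j, Xs R M j ≠ R i := by
  have key : ∀ i j, i < j → j ∈ M → R i + 2 ≤ R j := by
    intro i j hij hj
    have h0 : j ≠ 0 := by rintro rfl; exact absurd hij (Fin.not_lt_zero _)
    have h1 := hM j hj h0
    have h2 := hR (pred_lt h0)
    have h3 := hR.monotone (le_pred hij)
    omega
  constructor
  · intro i j hij
    unfold Xs
    have h1 := hR hij
    by_cases hj : j ∈ M
    · have := key i j hij hj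
      split_ifs <;> omega
    · simp only [hj, if_false]
      split_ifs <;> omega
  · intro i hi j h
    unfold Xs at h
    rcases lt_trichotomy j i with h1 | h1 | h1
    · have := hR h1
      split_ifs at h <;> omega
    · subst h1
      simp only [hi, if_true] at h
      omega
    · have := hR h1
      by_cases hj : j ∈ M
      · have := key i j h1 hj
        simp only [hj, if_true] at h
        omega
      · simp only [hj, if_false] at h
        omega

lemma mono_image_eq {X W : Fin (p+1) → ℤ} (hX : StrictMono X) (hW : StrictMono W)
    (h : Finset.image X Finset.univ = Finset.image W Finset.univ) : X = W := by
  apply (StrictMono.range_inj hX hW).mp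
  have := congrArg (fun s : Finset ℤ => (s : Set ℤ)) h
  simpa using this

lemma cyc_succ_iff (L : ℕ) (X : Fin (p+1) → ℤ) (hX : IsConfig L (p+1) X) (i : Fin (p+1)) :
    (∀ j, X j ≠ (if X i = (L : ℤ) then 1 else X i + 1)) ↔ fst L X (i + 1) := by
  unfold fst
  rw [add_sub_cancel_right]
  have b := hX.2 i
  constructor
  · intro h hc
    by_cases h1 : i + 1 = 0
    · have hb := hX.2 0
      have hb2 := h 0
      rw [h1] at hc
      simp only [if_true] at hc
      split_ifs at hb2 <;> omega
    · have hb := hX.2 (i+1)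
      have hb2 := h (i+1)
      simp only [h1, if_false] at hc
      split_ifs at hb2 <;> omega
  · intro h j hc
    apply h
    split_ifs at hc with h1
    · have il : i = Fin.last p := by
        by_contra hne
        have := hX.1 (Fin.lt_last_iff_ne_last.mpr hne)
        have := (hX.2 (Fin.last p)).2
        omega
      have j0 : j = 0 := by
        by_contra hne
        have := hX.1 (Fin.pos_of_ne_zero hne)
        have := (hX.2 0).1
        omega
      have := add_one_eq_zero.mpr il
      rw [if_pos this, this, ← j0]
      omega
    · have hij : i < j := by
        apply hX.1.lt_iff_lt.mp; omega
      have hnl : i ≠ Fin.last p := by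
        rintro rfl; exact absurd (Fin.le_last j) (not_le.mpr hij)
      have h0 : i + 1 ≠ 0 := fun h => hnl (add_one_eq_zero.mp h)
      rw [if_neg h0]
      have h3 := hX.1 (pred_lt h0)
      rw [add_sub_cancel_right] at h3
      have h4 : i + 1 ≤ j := by
        have := val_succ_cyc i
        rw [if_neg h0] at this
        rw [Fin.lt_def] at hij
        rw [Fin.le_def]; omega
      have h5 := hX.1.monotone h4
      omega

noncomputable def SS (L : ℤ) (X : Fin (p+1) → ℤ) : Finset (Fin (p+1)) :=
  Finset.univ.filter fun i => fst L X i

lemma Nc_eq (L : ℕ) (X : Fin (p+1) → ℤ) (hX : IsConfig L (p+1) X) : Nc L X = (SS L X).card := by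
  unfold Nc SS
  apply Finset.card_equiv (Equiv.addRight (1 : Fin (p+1)))
  intro i
  simp only [Finset.mem_filter, Finset.mem_univ, true_and, Equiv.coe_addRight]
  exact cyc_succ_iff L X hX i

lemma exists_fst (L : ℤ) (hL : (p:ℤ) + 1 < L) (X : Fin (p+1) → ℤ) : ∃ i, fst L X i := by
  by_contra hc
  push Not at hc
  unfold fst at hc
  push Not at hc
  have h1 : ∑ i, X i = ∑ i : Fin (p+1), (X (i-1) + 1 - if i = 0 then L else 0) :=
    Finset.sum_congr rfl fun i _ => hc i
  rw [Finset.sum_sub_distrib, Finset.sum_add_distrib, Finset.sum_ite_eq'] at h1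
  have h2 : ∑ i : Fin (p+1), X (i-1) = ∑ i, X i := Equiv.sum_comp (Equiv.subRight (1 : Fin (p+1))) X
  rw [h2] at h1
  simp at h1
  omega

def okk (L : ℕ) (X Z : Fin (p+1) → ℤ) (M : Finset (Fin (p+1))) : Prop :=
  (∀ i ∈ M, ∀ j, Z j ≠ succSite L (Z i)) ∧
          (Finset.image X Finset.univ =
            Finset.image (fun i => if i ∈ M then succSite L (Z i) else Z i) Finset.univ)

lemma ok_fwd (L : ℕ) (X Z : Fin (p+1) → ℤ) (M : Finset (Fin (p+1)))
    (hX : IsConfig L (p+1) X) (hZ : IsConfig L (p+1) Z) (h : okk L X Z M) :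
    (Z = Xs X M ∧ (∀ i ∈ M, fst L X i) ∧ ¬ (X 0 = 1 ∧ 0 ∈ M)) ∨
    (Z = Xs (rotX L X) M ∧ (∀ i ∈ M, fst L X (i+1)) ∧ X 0 = 1 ∧ Fin.last p ∈ M) := by
  obtain ⟨h1, h2⟩ := h
  have hc : ∀ i ∈ M, Z i ≠ L → ∀ j, Z j ≠ Z i + 1 := by
    intro i hi hl j
    have := h1 i hi j
    simpa [succSite, hl] using this
  let Q : Fin (p+1) → ℤ := fun i => Z i + if i ∈ M then 1 else 0
  have hQd : ∀ i, Q i = Z i + if i ∈ M then 1 else 0 := fun _ => rfl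
  have hZQ : Z = Xs Q M := by ext i; simp [Xs, Q]
  have hQ : StrictMono Q := by
    intro i j hij
    have e := hZ.1 hij
    have b := hZ.2 j
    rw [hQd, hQd]
    by_cases hi : i ∈ M
    · have := hc i hi (by omega) j
      split_ifs <;> omega
    · split_ifs <;> omega
  have hQf : ∀ i ∈ M, i ≠ 0 → Q i ≠ Q (i-1) + 1 := by
    intro i hi h0 he
    have e := hZ.1 (pred_lt h0)
    have b := hZ.2 i
    rw [hQd, hQd, if_pos hi] at he
    split_ifs at he with h3
    · exact hc (i-1) h3 (by omega) i (by omega)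
    · omega
  by_cases hw : Fin.last p ∈ M ∧ Z (Fin.last p) = L
  · right
    obtain ⟨hw1, hw2⟩ := hw
    have hz0 : Z 0 ≠ 1 := by
      have := h1 _ hw1 0
      simpa [succSite, hw2] using this
    have hb0 := hZ.2 0
    have hQl : Q (Fin.last p) = L + 1 := by rw [hQd, if_pos hw1, hw2]
    have hQ0 : 2 ≤ Q 0 := by rw [hQd]; split_ifs <;> omega
    let W : Fin (p+1) → ℤ := fun k => Q (k-1) - if k = 0 then (L:ℤ) else 0
    have hW : StrictMono W := by
      intro i j hij
      have hj0 : j ≠ 0 := by rintro rfl; exact absurd hij (Fin.not_lt_zero _)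
      simp only [W, if_neg hj0]
      by_cases hi0 : i = 0
      · subst hi0
        rw [if_pos rfl, zero_sub_one, hQl]
        have := hQ.monotone (Fin.zero_le (j-1))
        omega
      · rw [if_neg hi0, sub_zero, sub_zero]
        exact hQ ((pred_lt hi0).trans_le (le_pred hij))
    have hXW : X = W := by
      apply mono_image_eq hX.1 hW
      rw [h2]
      have e : (fun i => if i ∈ M then succSite L (Z i) else Z i) = W ∘ (Equiv.addRight (1 : Fin (p+1))) := by
        ext i
        simp only [W, Function.comp, Equiv.coe_addRight, add_sub_cancel_right, add_one_eq_zero, succSite]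
        by_cases hi : i = Fin.last p
        · subst hi
          simp [hw1, hw2, hQl]
        · have hne : Z i ≠ L := by
            have := hZ.1 (Fin.lt_last_iff_ne_last.mpr hi)
            omega
          rw [if_neg hne, if_neg hi, hQd]
          split_ifs <;> omega
      rw [e]
      ext x
      simp only [Finset.mem_image, Finset.mem_univ, true_and, Function.comp]
      constructor
      · rintro ⟨a, ha⟩; exact ⟨_, ha⟩
      · rintro ⟨a, ha⟩; exact ⟨(Equiv.addRight (1 : Fin (p+1))).symm a, by rw [Equiv.apply_symm_apply]; exact ha⟩
    have hrot : rotX L X = Q := by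
      ext i
      simp [rotX, hXW, W]
    have hX0 : X 0 = 1 := by
      rw [hXW]; simp only [W, if_true, zero_sub_one, hQl]; omega
    refine ⟨by rw [hrot]; exact hZQ, ?_, hX0, hw1⟩
    intro i hi
    rw [← fst_rot, hrot]
    by_cases h0 : i = 0
    · subst h0
      unfold fst
      rw [zero_sub_one, hQl, if_pos rfl, hQd, if_pos hi]
      omega
    · unfold fst
      rw [if_neg h0, sub_zero]
      exact hQf i hi h0
  · left
    have hne : ∀ i ∈ M, Z i ≠ L := by
      intro i hi hl
      by_cases hil : i = Fin.last p
      · subst hil; exact hw ⟨hi, hl⟩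
      · have := hZ.1 (Fin.lt_last_iff_ne_last.mpr hil)
        have := (hZ.2 (Fin.last p)).2
        omega
    have hXQ : X = Q := by
      apply mono_image_eq hX.1 hQ
      rw [h2]
      congr 1
      ext i
      rw [hQd]
      split_ifs with hi
      · simp [succSite, hne i hi]
      · omega
    refine ⟨by rw [hXQ]; exact hZQ, ?_, ?_⟩
    · intro i hi
      unfold fst
      by_cases h0 : i = 0
      · subst h0
        have b1 := hX.2 (0 - 1)
        have b2 := hZ.2 0
        have : X 0 = Z 0 + 1 := by rw [hXQ, hQd, if_pos hi]
        rw [if_pos rfl]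
        omega
      · rw [if_neg h0, sub_zero, hXQ]
        exact hQf i hi h0
    · rintro ⟨h3, h4⟩
      have b2 := hZ.2 0
      have : X 0 = Z 0 + 1 := by rw [hXQ, hQd, if_pos h4]
      omega

lemma ok_bwd1 (L : ℕ) (X : Fin (p+1) → ℤ) (M : Finset (Fin (p+1)))
    (hX : IsConfig L (p+1) X) (hM : ∀ i ∈ M, fst L X i) (h0 : ¬ (X 0 = 1 ∧ 0 ∈ M)) :
    IsConfig L (p+1) (Xs X M) ∧ okk L X (Xs X M) M := by
  obtain ⟨a1, a2⟩ := lemA X hX.1 M (by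
    intro i hi hi0
    have := hM i hi
    unfold fst at this
    simpa [hi0] using this)
  have hXs : ∀ i, Xs X M i = X i - if i ∈ M then 1 else 0 := fun _ => rfl
  have hsucc : ∀ i ∈ M, succSite L (Xs X M i) = X i := by
    intro i hi
    have := (hX.2 i).2
    rw [hXs, if_pos hi]
    unfold succSite
    split_ifs <;> omega
  refine ⟨⟨a1, fun i => ⟨?_, ?_⟩⟩, ?_, ?_⟩
  · have h1 := a1.monotone (Fin.zero_le i)
    have h2 : 1 ≤ Xs X M 0 := by
      rw [hXs]
      have := (hX.2 0).1
      split_ifs with h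
      · have : X 0 ≠ 1 := fun hh => h0 ⟨hh, h⟩
        omega
      · omega
    omega
  · rw [hXs]
    have := (hX.2 i).2
    split_ifs <;> omega
  · intro i hi j
    rw [hsucc i hi]
    exact a2 i hi j
  · congr 1
    ext i
    split_ifs with hi
    · exact (hsucc i hi).symm
    · rw [hXs, if_neg hi, sub_zero]

lemma ok_bwd2 (L : ℕ) (X : Fin (p+1) → ℤ) (M : Finset (Fin (p+1)))
    (hX : IsConfig L (p+1) X) (hL : p + 1 < L) (hM : ∀ i ∈ M, fst L X (i+1)) (hX0 : X 0 = 1) (hl : Fin.last p ∈ M) :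
    IsConfig L (p+1) (Xs (rotX L X) M) ∧ okk L X (Xs (rotX L X) M) M := by
  set R := rotX L X with hRd
  have hRe : ∀ i, R i = X (i+1) + if i + 1 = 0 then (L:ℤ) else 0 := fun _ => rfl
  have hRl : R (Fin.last p) = L + 1 := by
    have : Fin.last p + 1 = 0 := add_one_eq_zero.mpr rfl
    rw [hRe, if_pos this, this, hX0]; ring
  have hR : StrictMono R := by
    intro i j hij
    have hi : i + 1 ≠ 0 := by
      intro h; rw [add_one_eq_zero.mp h] at hij; exact absurd (Fin.le_last j) (not_le.mpr hij)
    rw [hRe, hRe, if_neg hi]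
    split_ifs with hj
    · rw [hj, hX0]; have := (hX.2 (i+1)).2; omega
    · rw [add_zero, add_zero]
      apply hX.1
      have v1 := val_succ_cyc i
      have v2 := val_succ_cyc j
      rw [if_neg hi] at v1
      rw [if_neg hj] at v2
      rw [Fin.lt_def] at hij ⊢
      omega
  have hMR : ∀ i ∈ M, fst L R i := fun i hi => (fst_rot L X i).mpr (hM i hi)
  obtain ⟨a1, a2⟩ := lemA R hR M (by
    intro i hi hi0
    have := hMR i hi
    unfold fst at this
    simpa [hi0] using this)
  have hXs : ∀ i, Xs R M i = R i - if i ∈ M then 1 else 0 := fun _ => rfl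
  have hZl : Xs R M (Fin.last p) = L := by rw [hXs, if_pos hl, hRl]; ring
  have hR0 : 2 ≤ R 0 := by
    rw [hRe]
    split_ifs with h
    · rw [h, hX0]; omega
    · have := hX.1 (Fin.pos_of_ne_zero h)
      omega
  have hZ0 : 2 ≤ Xs R M 0 := by
    rw [hXs]
    split_ifs with h
    · have := hMR 0 h
      unfold fst at this
      rw [zero_sub_one, hRl, if_pos rfl] at this
      omega
    · omega
  have hsucc : ∀ i ∈ M, i ≠ Fin.last p → succSite L (Xs R M i) = R i := by
    intro i hi hil
    have := a1 (Fin.lt_last_iff_ne_last.mpr hil)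
    rw [hZl, hXs, if_pos hi] at this
    rw [hXs, if_pos hi]
    unfold succSite
    split_ifs <;> omega
  refine ⟨⟨a1, fun i => ⟨?_, ?_⟩⟩, ?_, ?_⟩
  · have h1 := a1.monotone (Fin.zero_le i)
    omega
  · have h1 := a1.monotone (Fin.le_last i)
    omega
  · intro i hi j
    by_cases hil : i = Fin.last p
    · subst hil
      rw [hZl]
      have h1 := a1.monotone (Fin.zero_le j)
      simp [succSite]
      omega
    · rw [hsucc i hi hil]
      exact a2 i hi j
  · have e : (fun i => if i ∈ M then succSite L (Xs R M i) else Xs R M i) = X ∘ (Equiv.addRight (1 : Fin (p+1))) := by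
      ext i
      simp only [Function.comp, Equiv.coe_addRight]
      by_cases hil : i = Fin.last p
      · subst hil
        have : Fin.last p + 1 = 0 := add_one_eq_zero.mpr rfl
        rw [if_pos hl, hZl, this, hX0]; simp [succSite]
      · have h1 : i + 1 ≠ 0 := fun h => hil (add_one_eq_zero.mp h)
        have h2 : R i = X (i+1) := by rw [hRe, if_neg h1, add_zero]
        rw [← h2]
        split_ifs with hi
        · exact hsucc i hi hil
        · rw [hXs, if_neg hi, sub_zero]
    rw [e]
    ext x
    simp only [Finset.mem_image, Finset.mem_univ, true_and, Function.comp]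
    constructor
    · rintro ⟨a, ha⟩; exact ⟨(Equiv.addRight (1 : Fin (p+1))).symm a, by rw [Equiv.apply_symm_apply]; exact ha⟩
    · rintro ⟨a, ha⟩; exact ⟨_, ha⟩

end alg5

section alg6
variable {p : ℕ} {f : ℤ → ℤ → ℕ → ℂ} {v lam : ℂ}

lemma W_eq (hf : Good f v lam) (L : ℤ) (X : Fin (p+1) → ℤ) :
    ∏ i, (if fst L X i then 1 else 1 + lam) = (1 - v) ^ (((SS L X).card : ℤ) - ((p+1 : ℕ) : ℤ)) := by
  have h1 : 1 + lam = (1 - v)⁻¹ := by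
    have := hf.hl
    have := hf.hv
    field_simp
    linear_combination hf.hl
  rw [Finset.prod_ite, Finset.prod_const_one, one_mul, Finset.prod_const, h1]
  have h2 : (Finset.univ.filter fun i => ¬ fst L X i).card + (SS L X).card = p + 1 := by
    unfold SS
    have := Finset.card_filter_add_card_filter_not (s := (Finset.univ : Finset (Fin (p+1)))) (fun i => fst L X i)
    simp at this
    omega
  rw [inv_pow, ← zpow_natCast, ← zpow_neg]
  congr 1; omega

lemma cf_eq (hf : Good f v lam) (L : ℤ) (X : Fin (p+1) → ℤ) (M : Finset (Fin (p+1))) :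
    cf L v X M = if M ⊆ SS L X then v ^ M.card * (1 - v) ^ (((SS L X).card : ℤ) - M.card) else 0 := by
  have hmem : ∀ i, i ∈ SS L X ↔ fst L X i := by intro i; simp [SS]
  unfold cf
  split_ifs with h
  · rw [Finset.prod_ite]
    have e1 : (Finset.univ.filter fun i => i ∈ M) = M := by ext; simp
    rw [e1, Finset.prod_congr rfl (g := fun _ => v) (fun i hi => if_pos ((hmem i).mp (h hi))),
      Finset.prod_const, Finset.prod_ite, Finset.prod_const_one, mul_one, Finset.prod_const]
    congr 1
    have e2 : ((Finset.univ.filter fun i => i ∉ M).filter fun i => fst L X i) = SS L X \ M := by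
      ext i; simp [hmem]; tauto
    rw [e2, Finset.card_sdiff_of_subset h, ← zpow_natCast]
    congr 1
    have := Finset.card_le_card h
    omega
  · rw [Finset.not_subset] at h
    obtain ⟨i, hi, hn⟩ := h
    apply Finset.prod_eq_zero (Finset.mem_univ i)
    rw [hmem] at hn
    simp [hi, hn]

set_option maxHeartbeats 1000000 in
lemma Tpow_cfg (v : ℝ) (L : ℕ) (f : ℤ → ℤ → ℕ → ℂ) (lam : ℂ) (hf : Good f (v:ℂ) lam) (hL : p + 1 < L)
    (Y : Fin (p+1) → ℤ) (hY : IsConfig L (p+1) Y) (t : ℕ) : ∀ X, IsConfig L (p+1) X →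
    ((Tpow v L (p+1) t X Y : ℝ) : ℂ) * (1 - (v:ℂ)) ^ ((Nc L X : ℤ) - ((p+1 : ℕ) : ℤ)) = FF f L X Y t := by
  have hL' : (p:ℤ) + 1 < (L:ℤ) := by exact_mod_cast hL
  induction t with
  | zero =>
    intro X hX
    rw [FF_zero hf L hL' X Y hX hY, W_eq hf, Nc_eq L X hX]
    by_cases h : X = Y <;> simp [Tpow, h]
  | succ t ih =>
    intro X hX
    have hv := hf.hv
    obtain ⟨k, hk⟩ := exists_fst (L:ℤ) hL' X
    rw [star hf L hL' Y t k k.2 X hk, Nc_eq L X hX]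
    have hmem : ∀ i, i ∈ SS L X ↔ fst L X i := by intro i; simp [SS]
    let G : (Fin (p+1) → ℤ) → ℂ := fun Z => FF f L Z Y t
    let K : Finset (Fin (p+1)) → ℂ := fun M => (v:ℂ) ^ M.card * (1 - (v:ℂ)) ^ (((p+1 : ℕ) : ℤ) - M.card)
    let c1 : Finset (Fin (p+1)) → Prop := fun M => (∀ i ∈ M, fst L X i) ∧ ¬ (X 0 = 1 ∧ 0 ∈ M)
    let c2 : Finset (Fin (p+1)) → Prop := fun M => (∀ i ∈ M, fst L X (i+1)) ∧ X 0 = 1 ∧ Fin.last p ∈ M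
    let a1 : Finset (Fin (p+1)) → ℂ := fun M => if c1 M then K M * G (Xs X M) else 0
    let a2 : Finset (Fin (p+1)) → ℂ := fun M => if c2 M then K M * G (Xs (rotX L X) M) else 0
    have hR0 : X 0 < rotX L X 0 := by
      have b := hX.2 (0+1)
      have b0 := hX.2 0
      simp only [rotX]
      split_ifs with h
      · rw [h]; omega
      · have := hX.1 (Fin.pos_of_ne_zero h)
        omega
    have hterm : ∀ Z, ((Tmat v L (p+1) X Z * Tpow v L (p+1) t Z Y : ℝ) : ℂ) =
        ∑ M, ((if Z = Xs X M then a1 M else 0) + (if Z = Xs (rotX L X) M then a2 M else 0)) := by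
      intro Z
      have hiff : ∀ M, (IsConfig L (p+1) Z ∧ okk L X Z M) ↔
          ((Z = Xs X M ∧ c1 M) ∨ (Z = Xs (rotX L X) M ∧ c2 M)) := by
        intro M
        constructor
        · rintro ⟨h1, h2⟩
          exact ok_fwd L X Z M hX h1 h2
        · rintro (⟨rfl, h1, h2⟩ | ⟨rfl, h1, h2, h3⟩)
          · exact ok_bwd1 L X M hX h1 h2
          · exact ok_bwd2 L X M hX hL h1 h2 h3
      have hex : ∀ M, ¬ (Z = Xs X M ∧ Z = Xs (rotX L X) M) := by
        rintro M ⟨h1, h2⟩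
        have := congrFun (h1.symm.trans h2) 0
        simp only [Xs] at this
        omega
      by_cases hZ : IsConfig L (p+1) Z
      · unfold Tmat
        rw [if_pos ⟨hX, hZ⟩]
        push_cast
        rw [Finset.sum_mul]
        refine Finset.sum_congr rfl fun M _ => ?_
        have hi := hiff M
        simp only [hZ, true_and] at hi
        have ihZ := ih Z hZ
        by_cases hok : okk L X Z M
        · have hval : ((v ^ M.card * (1 - v) ^ ((Nc L Z : ℤ) - M.card) : ℝ) : ℂ) * (Tpow v L (p+1) t Z Y : ℂ)
              = K M * G Z := by
            simp only [K, G]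
            rw [← ihZ]
            push_cast
            have : (1 - (v:ℂ)) ^ ((Nc L Z : ℤ) - M.card) =
              (1 - (v:ℂ)) ^ (((p+1 : ℕ) : ℤ) - M.card) * (1 - (v:ℂ)) ^ ((Nc L Z : ℤ) - ((p+1 : ℕ) : ℤ)) := by
              rw [← zpow_add₀ hv]; congr 1; ring
            push_cast at this
            rw [this]; ring
          have hok2 := hok
          unfold okk at hok2
          rw [if_pos hok2, hval]
          rcases hi.mp hok with ⟨e1, e2⟩ | ⟨e1, e2⟩
          · have e3 : ¬ Z = Xs (rotX L X) M := fun h => hex M ⟨e1, h⟩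
            rw [if_neg e3, if_pos e1, add_zero]
            simp only [a1, if_pos e2]
            rw [e1]
          · have e3 : ¬ Z = Xs X M := fun h => hex M ⟨h, e1⟩
            rw [if_neg e3, if_pos e1, zero_add]
            simp only [a2, if_pos e2]
            rw [e1]
        · have hok2 := hok
          unfold okk at hok2
          rw [if_neg hok2]
          have hn := mt hi.mpr hok
          simp only [a1, a2]
          rw [← ite_and, ← ite_and, if_neg (fun h => hn (Or.inl h)), if_neg (fun h => hn (Or.inr h))]
          simp
      · unfold Tmat
        rw [if_neg (fun h => hZ h.2)]
        symm
        rw [zero_mul, Complex.ofReal_zero]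
        refine Finset.sum_eq_zero fun M _ => ?_
        have hn := mt (hiff M).mpr (fun h => hZ h.1)
        simp only [a1, a2]
        rw [← ite_and, ← ite_and, if_neg (fun h => hn (Or.inl h)), if_neg (fun h => hn (Or.inr h))]
        simp
    have hsum : ((Tpow v L (p+1) (t+1) X Y : ℝ) : ℂ) = ∑ M, (a1 M + a2 M) := by
      change ((∑' Z, Tmat v L (p+1) X Z * Tpow v L (p+1) t Z Y : ℝ) : ℂ) = _
      rw [Complex.ofReal_tsum]
      simp only [hterm]
      apply HasSum.tsum_eq
      apply hasSum_sum
      intro M _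
      exact (hasSum_ite_eq _ _).add (hasSum_ite_eq _ _)
    rw [hsum, Finset.sum_add_distrib]
    let e : Finset (Fin (p+1)) ≃ Finset (Fin (p+1)) := (Equiv.addRight (1 : Fin (p+1))).finsetCongr
    have he : ∀ M i, i + 1 ∈ e M ↔ i ∈ M := by
      intro M i
      simp [e, Equiv.finsetCongr_apply]
    have hcard : ∀ M, (e M).card = M.card := by
      intro M; simp [e, Equiv.finsetCongr_apply]
    let a3 : Finset (Fin (p+1)) → ℂ := fun M =>
      if (∀ i ∈ M, fst L X i) ∧ X 0 = 1 ∧ 0 ∈ M then K M * G (Xs X M) else 0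
    have h2 : ∑ M, a2 M = ∑ M, a3 M := by
      rw [← e.sum_comp a3]
      refine Finset.sum_congr rfl fun M _ => ?_
      have q1 : (0 ∈ e M) ↔ Fin.last p ∈ M := by
        rw [← he M (Fin.last p), add_one_eq_zero.mpr rfl]
      have q2 : (∀ i ∈ e M, fst L X i) ↔ ∀ i ∈ M, fst L X (i+1) := by
        constructor
        · intro h i hi; exact h _ ((he M i).mpr hi)
        · intro h i hi
          have := h (i - 1) ((he M (i-1)).mp (by rwa [sub_add_cancel]))
          rwa [sub_add_cancel] at this
      have q3 : G (Xs (rotX L X) M) = G (Xs X (e M)) := by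
        simp only [G]
        rw [← FF_rot L (Xs X (e M))]
        congr 1
        ext i
        simp only [Xs, rotX, he]
        ring
      have q4 : K (e M) = K M := by simp only [K, hcard]
      simp only [a2, a3, c2, q1, q2, q3, q4]
    rw [h2, ← Finset.sum_add_distrib, Finset.sum_mul]
    refine Finset.sum_congr rfl fun M _ => ?_
    rw [cf_eq hf]
    have q : M ⊆ SS L X ↔ ∀ i ∈ M, fst L X i := by
      constructor
      · intro h i hi; exact (hmem i).mp (h hi)
      · intro h i hi; exact (hmem i).mpr (h i hi)
    have hfin : K M * G (Xs X M) * (1 - (v:ℂ)) ^ (((SS L X).card : ℤ) - ((p+1 : ℕ) : ℤ)) =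
        (v:ℂ) ^ M.card * (1 - (v:ℂ)) ^ (((SS L X).card : ℤ) - M.card) * FF f L (Xs X M) Y t := by
      have : (1 - (v:ℂ)) ^ (((SS L X).card : ℤ) - M.card) =
          (1 - (v:ℂ)) ^ (((p+1 : ℕ) : ℤ) - M.card) * (1 - (v:ℂ)) ^ (((SS L X).card : ℤ) - ((p+1 : ℕ) : ℤ)) := by
        rw [← zpow_add₀ hv]; congr 1; ring
      rw [this]; simp only [K, G]; ring
    by_cases hs : ∀ i ∈ M, fst L X i
    · rw [if_pos (q.mpr hs)]
      by_cases h0 : X 0 = 1 ∧ 0 ∈ M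
      · have n1 : ¬ c1 M := fun h => h.2 h0
        simp only [a1, if_neg n1, a3, if_pos (And.intro hs h0), zero_add]
        exact hfin
      · have n1 : c1 M := ⟨hs, h0⟩
        have n2 : ¬ ((∀ i ∈ M, fst L X i) ∧ X 0 = 1 ∧ 0 ∈ M) := fun h => h0 h.2
        simp only [a1, if_pos n1, a3, if_neg n2, add_zero]
        exact hfin
    · rw [if_neg (mt q.mp hs)]
      have n1 : ¬ c1 M := fun h => hs h.1
      have n2 : ¬ ((∀ i ∈ M, fst L X i) ∧ X 0 = 1 ∧ 0 ∈ M) := fun h => hs h.1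
      simp only [a1, if_neg n1, a3, if_neg n2, add_zero, zero_mul]

end alg6

/-- for `1 ≤ P`, `2P ≤ L`, `0 < v < 1/2`, the `t`-step transition probability of the
parallel-update TASEP on the ring equals `F_L(X,X⁰,t)/F_L(X,X,0)`, and the denominator equals
`(1-v)^{N_c(X)-P} ≠ 0`. -/
theorem stmt0 (L P : ℕ) (hP : 1 ≤ P) (hL : 2 * P ≤ L)
    (v : ℝ) (hv0 : 0 < v) (hv1 : v < 1 / 2)
    (r : ℝ) (hr1 : 1 < r) (hr2 : r < 1 / (v / (1 - v)))
    (t : ℕ) (X X0 : Fin P → ℤ) (hX : IsConfig L P X) (hX0 : IsConfig L P X0) :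
    FL (v / (1 - v)) r L X X 0 = ((1 - v : ℝ) : ℂ) ^ ((Nc L X : ℤ) - P) ∧
    FL (v / (1 - v)) r L X X 0 ≠ 0 ∧
    ((Tpow v L P t X X0 : ℝ) : ℂ) =
      FL (v / (1 - v)) r L X X0 t / FL (v / (1 - v)) r L X X 0 := by
  obtain ⟨p, rfl⟩ : ∃ p, P = p + 1 := ⟨P - 1, by omega⟩
  have hf := good_fInt (v := v) (r := r) hv0 hv1 hr1 hr2
  have hFL : ∀ (A B : Fin (p+1) → ℤ) (s : ℕ), FL (v / (1 - v)) r L A B s =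
      FF (fInt (v / (1 - v)) r) L A B s := fun _ _ _ => rfl
  have hv : (1 - (v:ℂ)) ≠ 0 := hf.hv
  have h1 : FL (v / (1 - v)) r L X X 0 = ((1 - v : ℝ) : ℂ) ^ ((Nc L X : ℤ) - ((p + 1 : ℕ) : ℤ)) := by
    rw [hFL, FF_zero hf (L:ℤ) (by omega) X X hX hX, if_pos rfl, W_eq hf, Nc_eq L X hX]
    push_cast
    rfl
  have h2 : ((1 - v : ℝ) : ℂ) ^ ((Nc L X : ℤ) - ((p + 1 : ℕ) : ℤ)) ≠ 0 := by
    apply zpow_ne_zero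
    push_cast; exact hv
  refine ⟨h1, by rw [h1]; exact h2, ?_⟩
  rw [h1, eq_div_iff h2, hFL]
  have := Tpow_cfg v L _ _ hf (by omega) X0 hX0 t X hX
  rw [← this]
  push_cast
  rfl
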